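/- In the coordinate transport setting, assume the matrix A(x) with entries V_{ab}(x) + Ŵ_{ab}(x) is positive definite for every x ∈ Ω, and define H_{ij}(x) := Tr[ A(x)⁻¹ · S_i(x) · (D²Φ(x))⁻¹ · S_j(x) ], where S_i(x) is the matrix with (a,b)-entry V_{iab}(x) − Ŵ_{iab}(x). Then for every x ∈ Ω and every vector v ∈ ℝⁿ with Σ Φ_{ij}(x) v_i v_j = 1 such that Σ g_{ij}(x) v_i v_j = ‖g‖_h(x) (i.e. v attains the h-norm of g at x), one has ‖H‖_h(x) + 2 Σ_{i,j} (Lg)_{ij}(x) v_i v_j ≥ (‖g‖_h(x))², where Lg is the weighted tensor Laplacian of the Calabi tensor g. -/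

import Mathlib

noncomputable section
open scoped BigOperators
open Filter MeasureTheory

/-- Partial derivative `∂_i f`. -/
def pd {n : ℕ} (f : (Fin n → ℝ) → ℝ) (i : Fin n) : (Fin n → ℝ) → ℝ :=
  fun x => fderiv ℝ f x (Pi.single i 1)

/-- Second partial derivative `f_{ij}`. -/
def pd2 {n : ℕ} (f : (Fin n → ℝ) → ℝ) (i j : Fin n) : (Fin n → ℝ) → ℝ :=
  pd (pd f i) j

/-- Third partial derivative `f_{ijk}`. -/
def pd3 {n : ℕ} (f : (Fin n → ℝ) → ℝ) (i j k : Fin n) : (Fin n → ℝ) → ℝ :=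
  pd (pd2 f i j) k

/-- Fourth partial derivative `f_{ijkl}`. -/
def pd4 {n : ℕ} (f : (Fin n → ℝ) → ℝ) (i j k l : Fin n) : (Fin n → ℝ) → ℝ :=
  pd (pd3 f i j k) l

/-- Fifth partial derivative. -/
def pd5 {n : ℕ} (f : (Fin n → ℝ) → ℝ) (i j k l m : Fin n) : (Fin n → ℝ) → ℝ :=
  pd (pd4 f i j k l) m

/-- The Hessian matrix `D²Φ(x)`, with entries `Φ_{ij}(x)`. -/
def hess {n : ℕ} (Φ : (Fin n → ℝ) → ℝ) (x : Fin n → ℝ) : Matrix (Fin n) (Fin n) ℝ :=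
  Matrix.of fun i j => pd2 Φ i j x

/-- The inverse Hessian matrix, with entries `Φ^{ij}(x)`. -/
def ihess {n : ℕ} (Φ : (Fin n → ℝ) → ℝ) (x : Fin n → ℝ) : Matrix (Fin n) (Fin n) ℝ :=
  (hess Φ x)⁻¹

/-- The gradient `∇Φ(x)`. -/
def grad {n : ℕ} (Φ : (Fin n → ℝ) → ℝ) (x : Fin n → ℝ) : Fin n → ℝ :=
  fun i => pd Φ i x

/-- The Calabi tensor `g_{ij} = Σ Φ_{iab} Φ_{jcd} Φ^{ac} Φ^{bd}`. -/
def calabi {n : ℕ} (Φ : (Fin n → ℝ) → ℝ) (i j : Fin n) (x : Fin n → ℝ) : ℝ :=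
  ∑ a, ∑ b, ∑ c, ∑ d,
    pd3 Φ i a b x * pd3 Φ j c d x * ihess Φ x a c * ihess Φ x b d

/-- `W^i := (∂_i W)(∇Φ)`. -/
def Wop {n : ℕ} (Φ W : (Fin n → ℝ) → ℝ) (i : Fin n) (x : Fin n → ℝ) : ℝ :=
  pd W i (grad Φ x)

/-- `Ŵ_{ij} := Σ_{a,b} W^{ab} Φ_{ai} Φ_{bj}` where `W^{ab} = (∂²_{ab}W)(∇Φ)`. -/
def What2 {n : ℕ} (Φ W : (Fin n → ℝ) → ℝ) (i j : Fin n) (x : Fin n → ℝ) : ℝ :=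
  ∑ a, ∑ b, pd2 W a b (grad Φ x) * pd2 Φ a i x * pd2 Φ b j x

/-- `Ŵ_{ijk} := Σ_{a,b,c} W^{abc} Φ_{ai} Φ_{bj} Φ_{ck}` where `W^{abc} = (∂³_{abc}W)(∇Φ)`. -/
def What3 {n : ℕ} (Φ W : (Fin n → ℝ) → ℝ) (i j k : Fin n) (x : Fin n → ℝ) : ℝ :=
  ∑ a, ∑ b, ∑ c, pd3 W a b c (grad Φ x) * pd2 Φ a i x * pd2 Φ b j x * pd2 Φ c k x

/-- Christoffel symbols `Γ^k_{pq} = ½ Σ_m Φ^{km} Φ_{mpq}` of the Hessian metric. -/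
def Γh {n : ℕ} (Φ : (Fin n → ℝ) → ℝ) (k p q : Fin n) (x : Fin n → ℝ) : ℝ :=
  (1/2) * ∑ m, ihess Φ x k m * pd3 Φ m p q x

/-- Covariant derivative of a (0,1)-tensor: `(∇T)_{p i}`. -/
def covD1 {n : ℕ} (Φ : (Fin n → ℝ) → ℝ) (T : Fin n → (Fin n → ℝ) → ℝ)
    (p i : Fin n) (x : Fin n → ℝ) : ℝ :=
  pd (T i) p x - ∑ m, Γh Φ m p i x * T m x

/-- Covariant derivative of a (0,2)-tensor: `(∇T)_{p i j}`. -/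
def covD2 {n : ℕ} (Φ : (Fin n → ℝ) → ℝ) (T : Fin n → Fin n → (Fin n → ℝ) → ℝ)
    (p i j : Fin n) (x : Fin n → ℝ) : ℝ :=
  pd (T i j) p x - ∑ m, Γh Φ m p i x * T m j x - ∑ m, Γh Φ m p j x * T i m x

/-- Covariant derivative of a (0,3)-tensor: `(∇T)_{p i j k}`. -/
def covD3 {n : ℕ} (Φ : (Fin n → ℝ) → ℝ) (T : Fin n → Fin n → Fin n → (Fin n → ℝ) → ℝ)
    (p i j k : Fin n) (x : Fin n → ℝ) : ℝ :=
  pd (T i j k) p x - ∑ m, Γh Φ m p i x * T m j k x - ∑ m, Γh Φ m p j x * T i m k x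
    - ∑ m, Γh Φ m p k x * T i j m x

/-- Covariant derivative of a (0,4)-tensor: `(∇T)_{p i j k l}`. -/
def covD4 {n : ℕ} (Φ : (Fin n → ℝ) → ℝ)
    (T : Fin n → Fin n → Fin n → Fin n → (Fin n → ℝ) → ℝ)
    (p i j k l : Fin n) (x : Fin n → ℝ) : ℝ :=
  pd (T i j k l) p x - ∑ m, Γh Φ m p i x * T m j k l x - ∑ m, Γh Φ m p j x * T i m k l x
    - ∑ m, Γh Φ m p k x * T i j m l x - ∑ m, Γh Φ m p l x * T i j k m x

/-- Weighted tensor Laplacian of a (0,1)-tensor: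
`(LT)_i = Σ Φ^{pq}(∇∇T)_{pq i} − ½ Σ_p (Σ_m Φ^{pm} V_m + W^p)(∇T)_{p i}`. -/
def LT1 {n : ℕ} (Φ V W : (Fin n → ℝ) → ℝ) (T : Fin n → (Fin n → ℝ) → ℝ)
    (i : Fin n) (x : Fin n → ℝ) : ℝ :=
  (∑ p, ∑ q, ihess Φ x p q * covD2 Φ (covD1 Φ T) p q i x)
    - (1/2) * ∑ p, ((∑ m, ihess Φ x p m * pd V m x) + Wop Φ W p x) * covD1 Φ T p i x

/-- Weighted tensor Laplacian of a (0,2)-tensor. -/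
def LT2 {n : ℕ} (Φ V W : (Fin n → ℝ) → ℝ) (T : Fin n → Fin n → (Fin n → ℝ) → ℝ)
    (i j : Fin n) (x : Fin n → ℝ) : ℝ :=
  (∑ p, ∑ q, ihess Φ x p q * covD3 Φ (covD2 Φ T) p q i j x)
    - (1/2) * ∑ p, ((∑ m, ihess Φ x p m * pd V m x) + Wop Φ W p x) * covD2 Φ T p i j x

/-- Weighted tensor Laplacian of a (0,3)-tensor. -/
def LT3 {n : ℕ} (Φ V W : (Fin n → ℝ) → ℝ) (T : Fin n → Fin n → Fin n → (Fin n → ℝ) → ℝ)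
    (i j k : Fin n) (x : Fin n → ℝ) : ℝ :=
  (∑ p, ∑ q, ihess Φ x p q * covD4 Φ (covD3 Φ T) p q i j k x)
    - (1/2) * ∑ p, ((∑ m, ihess Φ x p m * pd V m x) + Wop Φ W p x) * covD3 Φ T p i j k x

/-- `N_{piab} := Φ_{piab} − ½ Σ_{k,m} Φ^{km}(Φ_{mpi}Φ_{kab} + Φ_{mpa}Φ_{kib} + Φ_{mpb}Φ_{kia})`. -/
def Ncal {n : ℕ} (Φ : (Fin n → ℝ) → ℝ) (p i a b : Fin n) (x : Fin n → ℝ) : ℝ :=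
  pd4 Φ p i a b x - (1/2) * ∑ k, ∑ m, ihess Φ x k m *
    (pd3 Φ m p i x * pd3 Φ k a b x + pd3 Φ m p a x * pd3 Φ k i b x
      + pd3 Φ m p b x * pd3 Φ k i a x)

/-- Riemann curvature `R_{ikjl} := ¼ Σ_{a,m} Φ^{am}(Φ_{ila}Φ_{mkj} − Φ_{ija}Φ_{mkl})`. -/
def Rcal {n : ℕ} (Φ : (Fin n → ℝ) → ℝ) (i k j l : Fin n) (x : Fin n → ℝ) : ℝ :=
  (1/4) * ∑ a, ∑ m, ihess Φ x a m *
    (pd3 Φ i l a x * pd3 Φ m k j x - pd3 Φ i j a x * pd3 Φ m k l x)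

/-- The `h`-norm of a quadratic form `Q` at `x`:
`‖Q‖_h(x) = sup { Σ Q_{ij} v_i v_j : Σ Φ_{ij}(x) v_i v_j = 1 }`. -/
def hnorm {n : ℕ} (Φ : (Fin n → ℝ) → ℝ) (Q : Fin n → Fin n → ℝ) (x : Fin n → ℝ) : ℝ :=
  sSup {r | ∃ v : Fin n → ℝ,
    (∑ i, ∑ j, pd2 Φ i j x * v i * v j) = 1 ∧ r = ∑ i, ∑ j, Q i j * v i * v j}

/-- The matrix `A(x)` with entries `V_{ab} + Ŵ_{ab}`. -/
def Amat {n : ℕ} (Φ V W : (Fin n → ℝ) → ℝ) (x : Fin n → ℝ) : Matrix (Fin n) (Fin n) ℝ :=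
  Matrix.of fun a b => pd2 V a b x + What2 Φ W a b x

/-- The matrix `S_i(x)` with entries `V_{iab} − Ŵ_{iab}`. -/
def Smat {n : ℕ} (Φ V W : (Fin n → ℝ) → ℝ) (i : Fin n) (x : Fin n → ℝ) :
    Matrix (Fin n) (Fin n) ℝ :=
  Matrix.of fun a b => pd3 V i a b x - What3 Φ W i a b x

/-- `H_{ij}(x) := Tr[A(x)⁻¹ · S_i(x) · (D²Φ(x))⁻¹ · S_j(x)]`. -/
def Hten {n : ℕ} (Φ V W : (Fin n → ℝ) → ℝ) (i j : Fin n) (x : Fin n → ℝ) : ℝ :=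
  ((Amat Φ V W x)⁻¹ * Smat Φ V W i x * (hess Φ x)⁻¹ * Smat Φ V W j x).trace

/-- Euclidean operator norm of a matrix. -/
def eOpNorm {n : ℕ} (M : Matrix (Fin n) (Fin n) ℝ) : ℝ :=
  ‖LinearMap.toContinuousLinearMap (Matrix.toEuclideanLin M)‖

/-- Directional derivative of the Hessian: the matrix `∂_e D²F(x)`. -/
def dirHess {n : ℕ} (F : (Fin n → ℝ) → ℝ) (e : Fin n → ℝ) (x : Fin n → ℝ) :
    Matrix (Fin n) (Fin n) ℝ :=
  Matrix.of fun i j => ∑ k, e k * pd3 F k i j x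

/-- The quadratic form `⟨Qy, y⟩`. -/
def qform {n : ℕ} (Q : Matrix (Fin n) (Fin n) ℝ) (y : Fin n → ℝ) : ℝ :=
  ∑ i, ∑ j, Q i j * y j * y i

/-! ### Directional derivatives of scalar and matrix fields -/

/-- `f` is differentiable at `x` and its derivative there in the direction `w` is `d`. -/
def HasDirDeriv {n : ℕ} (f : (Fin n → ℝ) → ℝ) (x w : Fin n → ℝ) (d : ℝ) : Prop :=
  DifferentiableAt ℝ f x ∧ fderiv ℝ f x w = d

/-- Entrywise directional differentiability of a matrix field. -/
def HasMatDeriv {n : ℕ} (M : (Fin n → ℝ) → Matrix (Fin n) (Fin n) ℝ) (x w : Fin n → ℝ)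
    (D : Matrix (Fin n) (Fin n) ℝ) : Prop :=
  ∀ a b, HasDirDeriv (fun y => M y a b) x w (D a b)

section Calculus

variable {n : ℕ} {x w : Fin n → ℝ}

namespace HasDirDeriv

variable {f g : (Fin n → ℝ) → ℝ} {d e : ℝ}

lemma unique (hf : HasDirDeriv f x w d) (hg : HasDirDeriv f x w e) : d = e :=
  hf.2.symm.trans hg.2

lemma congr (hf : HasDirDeriv f x w d) (h : f =ᶠ[nhds x] g) : HasDirDeriv g x w d :=
  ⟨hf.1.congr_of_eventuallyEq h.symm, by rw [← h.fderiv_eq, hf.2]⟩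

lemma const (c : ℝ) : HasDirDeriv (fun _ : Fin n → ℝ => c) x w 0 :=
  ⟨differentiableAt_const c, by simp⟩

lemma add (hf : HasDirDeriv f x w d) (hg : HasDirDeriv g x w e) :
    HasDirDeriv (fun y => f y + g y) x w (d + e) :=
  ⟨hf.1.add hg.1, by rw [fderiv_fun_add hf.1 hg.1]; simp [hf.2, hg.2]⟩

lemma neg (hf : HasDirDeriv f x w d) : HasDirDeriv (fun y => -f y) x w (-d) :=
  ⟨hf.1.neg, by rw [fderiv_fun_neg]; simp [hf.2]⟩

lemma sub (hf : HasDirDeriv f x w d) (hg : HasDirDeriv g x w e) :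
    HasDirDeriv (fun y => f y - g y) x w (d - e) := by
  simpa only [sub_eq_add_neg] using hf.add hg.neg

lemma mul (hf : HasDirDeriv f x w d) (hg : HasDirDeriv g x w e) :
    HasDirDeriv (fun y => f y * g y) x w (d * g x + f x * e) :=
  ⟨hf.1.mul hg.1, by rw [fderiv_fun_mul hf.1 hg.1]; simp [hf.2, hg.2]; ring⟩

lemma const_mul (c : ℝ) (hf : HasDirDeriv f x w d) :
    HasDirDeriv (fun y => c * f y) x w (c * d) := by
  simpa using (const c).mul hf

lemma sum {ι : Type*} {s : Finset ι} {F : ι → (Fin n → ℝ) → ℝ} {D : ι → ℝ}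
    (h : ∀ i ∈ s, HasDirDeriv (F i) x w (D i)) :
    HasDirDeriv (fun y => ∑ i ∈ s, F i y) x w (∑ i ∈ s, D i) := by
  classical
  induction s using Finset.induction_on with
  | empty => simpa using const 0
  | insert a s ha ih =>
    simp only [Finset.sum_insert ha]
    exact (h a (by simp)).add (ih fun i hi => h i (by simp [hi]))

end HasDirDeriv

lemma fderiv_eq_sum_pd (f : (Fin n → ℝ) → ℝ) (x w : Fin n → ℝ) :
    fderiv ℝ f x w = ∑ i, w i * pd f i x := by
  conv_lhs => rw [← Finset.univ_sum_single w]
  rw [map_sum]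
  refine Finset.sum_congr rfl fun i _ => ?_
  have : (Pi.single i (w i) : Fin n → ℝ) = w i • Pi.single i 1 := by
    rw [← Pi.single_smul, smul_eq_mul, mul_one]
  rw [this, map_smul, smul_eq_mul, pd]

lemma HasDirDeriv.of_differentiableAt {f : (Fin n → ℝ) → ℝ} (hf : DifferentiableAt ℝ f x) :
    HasDirDeriv f x w (∑ i, w i * pd f i x) :=
  ⟨hf, fderiv_eq_sum_pd f x w⟩

lemma HasDirDeriv.pd_eq {f : (Fin n → ℝ) → ℝ} {i : Fin n} {d : ℝ}
    (hf : HasDirDeriv f x (Pi.single i 1) d) : pd f i x = d := hf.2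

namespace HasMatDeriv

variable {M N : (Fin n → ℝ) → Matrix (Fin n) (Fin n) ℝ} {D E : Matrix (Fin n) (Fin n) ℝ}

lemma unique (hM : HasMatDeriv M x w D) (hN : HasMatDeriv M x w E) : D = E := by
  ext a b
  exact (hM a b).unique (hN a b)

lemma congr (hM : HasMatDeriv M x w D) (h : M =ᶠ[nhds x] N) : HasMatDeriv N x w D := fun a b =>
  (hM a b).congr (h.mono fun y hy => by simp [hy])

lemma const (C : Matrix (Fin n) (Fin n) ℝ) : HasMatDeriv (fun _ => C) x w 0 := fun a b =>
  HasDirDeriv.const (C a b)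

lemma add (hM : HasMatDeriv M x w D) (hN : HasMatDeriv N x w E) :
    HasMatDeriv (fun y => M y + N y) x w (D + E) := fun a b => (hM a b).add (hN a b)

lemma sub (hM : HasMatDeriv M x w D) (hN : HasMatDeriv N x w E) :
    HasMatDeriv (fun y => M y - N y) x w (D - E) := fun a b => (hM a b).sub (hN a b)

lemma mul (hM : HasMatDeriv M x w D) (hN : HasMatDeriv N x w E) :
    HasMatDeriv (fun y => M y * N y) x w (D * N x + M x * E) := fun a b => by
  simp only [Matrix.mul_apply, Matrix.add_apply, ← Finset.sum_add_distrib]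
  exact HasDirDeriv.sum fun c _ => (hM a c).mul (hN c b)

lemma smul {f : (Fin n → ℝ) → ℝ} {d : ℝ} (hf : HasDirDeriv f x w d) (hM : HasMatDeriv M x w D) :
    HasMatDeriv (fun y => f y • M y) x w (d • M x + f x • D) := fun a b => hf.mul (hM a b)

lemma const_smul (c : ℝ) (hM : HasMatDeriv M x w D) :
    HasMatDeriv (fun y => c • M y) x w (c • D) := fun a b => (hM a b).const_mul c

lemma sum {ι : Type*} {s : Finset ι} {F : ι → (Fin n → ℝ) → Matrix (Fin n) (Fin n) ℝ}
    {D : ι → Matrix (Fin n) (Fin n) ℝ} (h : ∀ i ∈ s, HasMatDeriv (F i) x w (D i)) :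
    HasMatDeriv (fun y => ∑ i ∈ s, F i y) x w (∑ i ∈ s, D i) := fun a b => by
  simp only [Matrix.sum_apply]
  exact HasDirDeriv.sum fun i hi => h i hi a b

lemma trace (hM : HasMatDeriv M x w D) :
    HasDirDeriv (fun y => (M y).trace) x w D.trace :=
  HasDirDeriv.sum fun a _ => hM a a

/-- The derivative in a general direction from those in the coordinate directions. -/
lemma of_single {D : Fin n → Matrix (Fin n) (Fin n) ℝ}
    (h : ∀ i, HasMatDeriv M x (Pi.single i 1) (D i)) : HasMatDeriv M x w (∑ i, w i • D i) := by
  intro a b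
  convert HasDirDeriv.of_differentiableAt (h a a b).1 using 1
  rw [Matrix.sum_apply]
  exact Finset.sum_congr rfl fun i _ => by rw [(h i a b).pd_eq]; rfl

/-- The derivative of the matrix inverse. -/
lemma inv (hM : HasMatDeriv M x w D) (hd : ∀ᶠ y in nhds x, IsUnit (M y).det)
    (hdiff : ∀ a b, DifferentiableAt ℝ (fun y => (M y)⁻¹ a b) x) :
    HasMatDeriv (fun y => (M y)⁻¹) x w (-((M x)⁻¹ * D * (M x)⁻¹)) := by
  have hx : IsUnit (M x).det := hd.self_of_nhds
  set E : Matrix (Fin n) (Fin n) ℝ :=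
    Matrix.of fun a b => fderiv ℝ (fun y => (M y)⁻¹ a b) x w with hE
  have hI : HasMatDeriv (fun y => (M y)⁻¹) x w E := fun a b => ⟨hdiff a b, rfl⟩
  have h1 : HasMatDeriv (fun y => M y * (M y)⁻¹) x w 0 :=
    (const 1).congr (hd.mono fun y hy => (Matrix.mul_nonsing_inv _ hy).symm)
  have h2 := (hM.mul hI).unique h1
  have h3 : E = -((M x)⁻¹ * D * (M x)⁻¹) := by
    have h4 := congrArg ((M x)⁻¹ * ·) h2
    simp only [Matrix.mul_add, ← Matrix.mul_assoc, Matrix.nonsing_inv_mul _ hx, Matrix.one_mul,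
      Matrix.mul_zero] at h4
    exact eq_neg_of_add_eq_zero_right h4
  exact h3 ▸ hI

end HasMatDeriv

/-! ### Smoothness of partial derivatives -/

lemma ContDiffOn.pd {f : (Fin n → ℝ) → ℝ} {Ω : Set (Fin n → ℝ)} (hΩ : IsOpen Ω) {k m : ℕ}
    (hf : ContDiffOn ℝ k f Ω) (hm : m + 1 ≤ k) (i : Fin n) : ContDiffOn ℝ m (pd f i) Ω :=
  (hf.fderiv_of_isOpen hΩ (by exact_mod_cast hm)).clm_apply contDiffOn_const

lemma ContDiffOn.differentiableAt_of_isOpen {f : (Fin n → ℝ) → ℝ} {Ω : Set (Fin n → ℝ)}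
    (hΩ : IsOpen Ω) {k : ℕ} (hf : ContDiffOn ℝ k f Ω) (hk : 1 ≤ k) (hx : x ∈ Ω) :
    DifferentiableAt ℝ f x :=
  (hf.differentiableOn (by exact_mod_cast (by omega : k ≠ 0))).differentiableAt (hΩ.mem_nhds hx)

lemma pd_congr {f g : (Fin n → ℝ) → ℝ} {Ω : Set (Fin n → ℝ)} (hΩ : IsOpen Ω)
    (h : ∀ y ∈ Ω, f y = g y) (i : Fin n) (hx : x ∈ Ω) : pd f i x = pd g i x := by
  have : f =ᶠ[nhds x] g := Filter.eventually_of_mem (hΩ.mem_nhds hx) h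
  rw [pd, pd, this.fderiv_eq]

/-- Schwarz's theorem for `pd2`. -/
lemma pd2_comm {f : (Fin n → ℝ) → ℝ} {Ω : Set (Fin n → ℝ)} (hΩ : IsOpen Ω) {k : ℕ}
    (hf : ContDiffOn ℝ k f Ω) (hk : 2 ≤ k) (hx : x ∈ Ω) (i j : Fin n) :
    pd2 f i j x = pd2 f j i x := by
  have hsym : IsSymmSndFDerivAt ℝ f x :=
    (hf.contDiffAt (hΩ.mem_nhds hx)).isSymmSndFDerivAt (by simpa using hk)
  have hd : DifferentiableAt ℝ (fderiv ℝ f) x :=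
    ((hf.fderiv_of_isOpen (m := 1) hΩ (by exact_mod_cast hk)).differentiableOn
      (by simp)).differentiableAt (hΩ.mem_nhds hx)
  have h : ∀ i j, pd2 f i j x = fderiv ℝ (fderiv ℝ f) x (Pi.single j 1) (Pi.single i 1) := by
    intro i j
    change fderiv ℝ (fun y => fderiv ℝ f y (Pi.single i 1)) x (Pi.single j 1) = _
    rw [fderiv_clm_apply hd (differentiableAt_const _)]
    simp
  rw [h, h, hsym.eq]

lemma pd3_comm_left {f : (Fin n → ℝ) → ℝ} {Ω : Set (Fin n → ℝ)} (hΩ : IsOpen Ω) {k : ℕ}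
    (hf : ContDiffOn ℝ k f Ω) (hk : 3 ≤ k) (hx : x ∈ Ω) (i j l : Fin n) :
    pd3 f i j l x = pd3 f j i l x :=
  pd_congr hΩ (fun _ hy => pd2_comm hΩ hf (by omega) hy i j) l hx

lemma pd3_comm_right {f : (Fin n → ℝ) → ℝ} {Ω : Set (Fin n → ℝ)} (hΩ : IsOpen Ω) {k : ℕ}
    (hf : ContDiffOn ℝ k f Ω) (hk : 3 ≤ k) (hx : x ∈ Ω) (i j l : Fin n) :
    pd3 f i j l x = pd3 f i l j x :=
  pd2_comm hΩ (hf.pd hΩ (m := k - 1) (by omega) i) (by omega) hx j l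

lemma pd3_rotate {f : (Fin n → ℝ) → ℝ} {Ω : Set (Fin n → ℝ)} (hΩ : IsOpen Ω) {k : ℕ}
    (hf : ContDiffOn ℝ k f Ω) (hk : 3 ≤ k) (hx : x ∈ Ω) (i j l : Fin n) :
    pd3 f i j l x = pd3 f l i j x := by
  rw [pd3_comm_right hΩ hf hk hx, pd3_comm_left hΩ hf hk hx]

lemma pd4_comm_left {f : (Fin n → ℝ) → ℝ} {Ω : Set (Fin n → ℝ)} (hΩ : IsOpen Ω) {k : ℕ}
    (hf : ContDiffOn ℝ k f Ω) (hk : 4 ≤ k) (hx : x ∈ Ω) (i j l m : Fin n) :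
    pd4 f i j l m x = pd4 f j i l m x :=
  pd_congr hΩ (fun _ hy => pd3_comm_left hΩ hf (by omega) hy i j l) m hx

lemma pd4_comm_mid {f : (Fin n → ℝ) → ℝ} {Ω : Set (Fin n → ℝ)} (hΩ : IsOpen Ω) {k : ℕ}
    (hf : ContDiffOn ℝ k f Ω) (hk : 4 ≤ k) (hx : x ∈ Ω) (i j l m : Fin n) :
    pd4 f i j l m x = pd4 f i l j m x :=
  pd_congr hΩ (fun _ hy => pd3_comm_right hΩ hf (by omega) hy i j l) m hx

lemma pd4_comm_right {f : (Fin n → ℝ) → ℝ} {Ω : Set (Fin n → ℝ)} (hΩ : IsOpen Ω) {k : ℕ}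
    (hf : ContDiffOn ℝ k f Ω) (hk : 4 ≤ k) (hx : x ∈ Ω) (i j l m : Fin n) :
    pd4 f i j l m x = pd4 f i j m l x :=
  pd3_comm_right hΩ (hf.pd hΩ (m := k - 1) (by omega) i) (by omega) hx j l m

end Calculus

/-! ### Linear algebra -/

section LinearAlgebra

open Matrix

variable {n : ℕ}

open scoped MatrixOrder in
lemma Matrix.PosSemidef.exists_eq_transpose_mul_self {A : Matrix (Fin n) (Fin n) ℝ}
    (hA : A.PosSemidef) : ∃ B : Matrix (Fin n) (Fin n) ℝ, A = Bᵀ * B := by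
  obtain ⟨B, hB⟩ := CStarAlgebra.nonneg_iff_eq_star_mul_self.mp hA.nonneg
  exact ⟨B, by rw [hB, star_eq_conjTranspose, conjTranspose_eq_transpose_of_trivial]⟩

lemma trace_mul_nonneg {A N : Matrix (Fin n) (Fin n) ℝ} (hA : A.PosSemidef) (hN : N.PosSemidef) :
    0 ≤ (A * N).trace := by
  obtain ⟨B, rfl⟩ := hA.exists_eq_transpose_mul_self
  rw [Matrix.mul_assoc, trace_mul_comm]
  simpa using (hN.mul_mul_conjTranspose_same B).trace_nonneg

/-- The Hilbert–Schmidt type quadratic form on families of matrices is nonnegative. -/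
lemma sum_sum_mul_trace_nonneg {P : Matrix (Fin n) (Fin n) ℝ} (hP : P.PosSemidef)
    (M : Fin n → Matrix (Fin n) (Fin n) ℝ) :
    0 ≤ ∑ p, ∑ q, P p q * (P * M p * P * (M q)ᵀ).trace := by
  obtain ⟨B, hB⟩ := hP.exists_eq_transpose_mul_self
  have key : ∑ p, ∑ q, P p q * (P * M p * P * (M q)ᵀ).trace
      = ∑ k, (P * ((∑ p, B k p • M p) * P * (∑ p, B k p • M p)ᵀ)).trace := by
    have hPpq : ∀ p q, P p q = ∑ k, B k p * B k q := fun p q => by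
      conv_lhs => rw [hB]
      simp [mul_apply]
    have hk : ∀ k, (P * ((∑ p, B k p • M p) * P * (∑ p, B k p • M p)ᵀ)).trace
        = ∑ p, ∑ q, B k p * B k q * (P * M p * P * (M q)ᵀ).trace := fun k => by
      simp only [transpose_sum, transpose_smul, Finset.sum_mul, Finset.mul_sum, trace_sum,
        Matrix.smul_mul, Matrix.mul_smul, trace_smul, smul_eq_mul, ← Matrix.mul_assoc]
      rw [Finset.sum_comm]
      refine Finset.sum_congr rfl fun p _ => Finset.sum_congr rfl fun q _ => by ring
    rw [Finset.sum_congr rfl fun k _ => hk k]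
    simp only [hPpq, Finset.sum_mul]
    rw [Finset.sum_comm_cycle]
  rw [key]
  refine Finset.sum_nonneg fun k _ => trace_mul_nonneg hP ?_
  simpa using hP.mul_mul_conjTranspose_same (∑ p, B k p • M p)

/-- Contraction of two families in their family index, for families which are symmetric under
exchange of the family index with an outer matrix index. -/
lemma sum_sum_smul_mul_mul_apply {P : Matrix (Fin n) (Fin n) ℝ} (hP : Pᵀ = P)
    {T Q : Fin n → Matrix (Fin n) (Fin n) ℝ} (hT : ∀ p b c, T p b c = T b p c)
    (hQ : ∀ q d e, Q q d e = Q e d q) (M : Matrix (Fin n) (Fin n) ℝ) (b e : Fin n) :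
    (∑ p, ∑ q, P p q • (T p * M * Q q)) b e = (P * T b * M * Q e).trace := by
  have hP' : ∀ p q, P p q = P q p := fun p q => congrFun (congrFun hP.symm p) q
  have h1 : (P * T b * M * Q e).trace = ∑ q, ∑ p, P q p * (T b * M * Q e) p q := by
    simp only [Matrix.mul_assoc, trace, diag_apply]
    refine Finset.sum_congr rfl fun q _ => by rw [mul_apply]
  rw [h1]
  conv_rhs => rw [Finset.sum_comm]
  simp only [Matrix.sum_apply, Matrix.smul_apply, smul_eq_mul]
  refine Finset.sum_congr rfl fun p _ => Finset.sum_congr rfl fun q _ => ?_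
  rw [hP' p q]
  congr 1
  simp only [mul_apply, hT p b, hQ q _ e]

lemma trace_cycle_three (P A B C : Matrix (Fin n) (Fin n) ℝ) :
    (P * A * P * B * P * C).trace = (P * B * P * C * P * A).trace := by
  simpa only [Matrix.mul_assoc] using trace_mul_comm (P * A) (P * B * P * C)

lemma trace_cycle_four (P A B C D : Matrix (Fin n) (Fin n) ℝ) :
    (P * A * P * B * P * C * P * D).trace = (P * B * P * C * P * D * P * A).trace := by
  simpa only [Matrix.mul_assoc] using trace_mul_comm (P * A) (P * B * P * C * P * D)

lemma trace_reverse_three {P A B C : Matrix (Fin n) (Fin n) ℝ} (hP : Pᵀ = P) (hA : Aᵀ = A)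
    (hB : Bᵀ = B) (hC : Cᵀ = C) :
    (P * A * P * B * P * C).trace = (P * C * P * B * P * A).trace := by
  rw [← trace_transpose]
  simp only [transpose_mul, hP, hA, hB, hC]
  simp only [← Matrix.mul_assoc]
  rw [trace_mul_comm]
  simp only [← Matrix.mul_assoc]

lemma sum_sum_swap {P : Matrix (Fin n) (Fin n) ℝ} (hP : Pᵀ = P) (f : Fin n → Fin n → ℝ) :
    ∑ p, ∑ q, P p q * f q p = ∑ p, ∑ q, P p q * f p q := by
  rw [Finset.sum_comm]
  refine Finset.sum_congr rfl fun p _ => Finset.sum_congr rfl fun q _ => ?_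
  rw [show P q p = P p q from congrFun (congrFun hP p) q]

/-- The quartic remainder in the Bochner formula for the Calabi tensor is nonnegative. -/
lemma calabi_remainder_nonneg {P X : Matrix (Fin n) (Fin n) ℝ} (hP : P.PosSemidef)
    (hX : Xᵀ = X) {T Q : Fin n → Matrix (Fin n) (Fin n) ℝ} (hT : ∀ p, (T p)ᵀ = T p)
    (hQ : ∀ p, (Q p)ᵀ = Q p) :
    0 ≤ 2 * ∑ p, ∑ q, P p q * (P * Q p * P * Q q).trace
      - 6 * ∑ p, ∑ q, P p q * (P * T p * P * Q q * P * X).trace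
      + (5 / 2) * ∑ p, ∑ q, P p q * (P * T p * P * T q * P * X * P * X).trace
      + 2 * ∑ p, ∑ q, P p q * (P * T p * P * X * P * T q * P * X).trace := by
  have hPt : Pᵀ = P := by simpa using hP.isHermitian.eq
  set a : Fin n → Fin n → ℝ := fun p q => (P * T p * P * Q q * P * X).trace with ha
  set c : Fin n → Fin n → ℝ := fun p q => (P * T p * P * T q * P * X * P * X).trace with hc
  set t : Fin n → Fin n → ℝ := fun p q => (P * T p * P * X * P * T q * P * X).trace with ht
  have r5 : ∀ p q, (P * X * P * T p * P * X * P * T q).trace = t p q := fun p q =>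
    trace_cycle_four P X (T p) X (T q)
  have r6 : ∀ p q, (P * X * P * T p * P * T q * P * X).trace = c p q := fun p q =>
    trace_cycle_four P X (T p) (T q) X
  have r7 : ∀ p q, (P * T p * P * X * P * X * P * T q).trace = c q p := fun p q =>
    (trace_cycle_four P (T q) (T p) X X).symm
  have e1 : ∀ p q, (P * (Q p - (3 / 4 : ℝ) • (X * P * T p + T p * P * X)) * P
        * (Q q - (3 / 4 : ℝ) • (X * P * T q + T q * P * X))ᵀ).trace
      = (P * Q p * P * Q q).trace - (3 / 2) * a p q - (3 / 2) * a q p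
        + (9 / 16) * (2 * t p q + c p q + c q p) := by
    intro p q
    have r1 : (P * Q p * P * X * P * T q).trace = a q p := (trace_cycle_three P (T q) (Q p) X).symm
    have r2 : (P * Q p * P * T q * P * X).trace = a q p := by
      rw [trace_reverse_three hPt (hQ p) (hT q) hX, trace_cycle_three]
    have r3 : (P * X * P * T p * P * Q q).trace = a p q := trace_cycle_three P X (T p) (Q q)
    have r4 : (P * T p * P * X * P * Q q).trace = a p q := by
      rw [trace_reverse_three hPt (hT p) hX (hQ q), ← trace_cycle_three]
    simp only [transpose_sub, transpose_smul, transpose_add, transpose_mul, hX, hPt, hT, hQ,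
      Matrix.mul_sub, Matrix.sub_mul, Matrix.mul_add, Matrix.add_mul, Matrix.mul_smul,
      Matrix.smul_mul, trace_sub, trace_add, trace_smul, smul_eq_mul, ← Matrix.mul_assoc, smul_add,
      smul_sub]
    rw [r1, r2, r3, r4, r5 p q, r6 p q, r7 p q, show _ = t p q from rfl]
    ring
  have e2 : ∀ p q, (P * (T p * P * X - X * P * T p) * P * (T q * P * X - X * P * T q)ᵀ).trace
      = c p q + c q p - 2 * t p q := by
    intro p q
    simp only [transpose_sub, transpose_mul, hX, hPt, hT, Matrix.mul_sub, Matrix.sub_mul, trace_sub,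
      ← Matrix.mul_assoc]
    rw [r5 p q, r6 p q, r7 p q]
    ring
  have h1 := sum_sum_mul_trace_nonneg hP
    fun p => Q p - (3 / 4 : ℝ) • (X * P * T p + T p * P * X)
  have h2 := sum_sum_mul_trace_nonneg hP fun p => T p * P * X - X * P * T p
  have s1 : ∑ p, ∑ q, P p q * ((P * Q p * P * Q q).trace - (3 / 2) * a p q - (3 / 2) * a q p
        + (9 / 16) * (2 * t p q + c p q + c q p))
      = ∑ p, ∑ q, P p q * (P * Q p * P * Q q).trace - 3 * ∑ p, ∑ q, P p q * a p q
        + (9 / 8) * ∑ p, ∑ q, P p q * t p q + (9 / 8) * ∑ p, ∑ q, P p q * c p q := by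
    have : ∀ p q, P p q * ((P * Q p * P * Q q).trace - (3 / 2) * a p q - (3 / 2) * a q p
        + (9 / 16) * (2 * t p q + c p q + c q p)) = P p q * (P * Q p * P * Q q).trace
        - (3 / 2) * (P p q * a p q) - (3 / 2) * (P p q * a q p) + (9 / 8) * (P p q * t p q)
        + (9 / 16) * (P p q * c p q) + (9 / 16) * (P p q * c q p) := fun p q => by ring
    simp only [this, Finset.sum_add_distrib, Finset.sum_sub_distrib, ← Finset.mul_sum]
    rw [sum_sum_swap hPt a, sum_sum_swap hPt c]
    ring
  have s2 : ∑ p, ∑ q, P p q * (c p q + c q p - 2 * t p q)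
      = 2 * ∑ p, ∑ q, P p q * c p q - 2 * ∑ p, ∑ q, P p q * t p q := by
    have : ∀ p q, P p q * (c p q + c q p - 2 * t p q)
        = P p q * c p q + P p q * c q p - 2 * (P p q * t p q) := fun p q => by ring
    simp only [this, Finset.sum_add_distrib, Finset.sum_sub_distrib, ← Finset.mul_sum]
    rw [sum_sum_swap hPt c]
    ring
  simp only [e1, e2] at h1 h2
  rw [s1] at h1
  rw [s2] at h2
  linarith

/-- Completion of the square for the trace form of a positive definite matrix `A`. -/
lemma trace_completed_square_nonneg {A P X S : Matrix (Fin n) (Fin n) ℝ} (hA : A.PosDef)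
    (hP : P.PosSemidef) (hX : Xᵀ = X) (hS : Sᵀ = S) :
    0 ≤ (A⁻¹ * S * P * S).trace - 4 * (P * S * P * X).trace
      + 4 * (P * A * P * X * P * X).trace := by
  have hPt : Pᵀ = P := by simpa using hP.isHermitian.eq
  have hAi : A⁻¹ᵀ = A⁻¹ := by simpa using hA.inv.isHermitian.eq
  have hu : IsUnit A.det := hA.det_pos.ne'.isUnit
  have h := trace_mul_nonneg hA.posSemidef
    (hP.mul_mul_conjTranspose_same (A⁻¹ * S - (2 : ℝ) • (P * X)))
  have h1 : A * ((A⁻¹ * S - (2 : ℝ) • (P * X)) * P * (A⁻¹ * S - (2 : ℝ) • (P * X))ᴴ)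
      = S * P * S * A⁻¹ - (2 : ℝ) • (S * P * X * P) - (2 : ℝ) • (A * (P * X * P * S * A⁻¹))
        + (4 : ℝ) • (A * P * X * P * X * P) := by
    rw [conjTranspose_eq_transpose_of_trivial]
    simp only [transpose_sub, transpose_smul, transpose_mul, hX, hPt, hS, hAi, Matrix.mul_sub,
      Matrix.sub_mul, Matrix.mul_smul, Matrix.smul_mul, ← Matrix.mul_assoc, mul_nonsing_inv A hu,
      Matrix.one_mul, smul_smul, smul_sub]
    norm_num
    abel
  have t1 : (S * P * S * A⁻¹).trace = (A⁻¹ * S * P * S).trace := by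
    rw [trace_mul_comm]
    simp only [Matrix.mul_assoc]
  have t2 : (S * P * X * P).trace = (P * S * P * X).trace := by
    rw [trace_mul_comm]
    simp only [Matrix.mul_assoc]
  have t3 : (A * (P * X * P * S * A⁻¹)).trace = (P * S * P * X).trace := by
    rw [trace_mul_comm, Matrix.mul_assoc _ A⁻¹ A, nonsing_inv_mul A hu, Matrix.mul_one,
      Matrix.mul_assoc, trace_mul_comm]
    simp only [Matrix.mul_assoc]
  have t4 : (A * P * X * P * X * P).trace = (P * A * P * X * P * X).trace := by
    rw [trace_mul_comm]
    simp only [Matrix.mul_assoc]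
  rw [h1] at h
  simp only [trace_add, trace_sub, trace_smul, smul_eq_mul, t1, t2, t3, t4] at h
  linarith

end LinearAlgebra

/-! ### The `h`-norm of a quadratic form -/

section HNorm

open Matrix

variable {n : ℕ}

lemma sum_sum_mul_mul_eq_dotProduct (M : Fin n → Fin n → ℝ) (v : Fin n → ℝ) :
    ∑ i, ∑ j, M i j * v i * v j = v ⬝ᵥ (Matrix.of M) *ᵥ v := by
  simp only [dotProduct, mulVec, of_apply, Finset.mul_sum]
  exact Finset.sum_congr rfl fun i _ => Finset.sum_congr rfl fun j _ => by ring

lemma dotProduct_transpose_mul_self_mulVec (B : Matrix (Fin n) (Fin n) ℝ) (v : Fin n → ℝ) :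
    v ⬝ᵥ (Bᵀ * B) *ᵥ v = (B *ᵥ v) ⬝ᵥ (B *ᵥ v) := by
  rw [← mulVec_mulVec, dotProduct_mulVec, vecMul_transpose]

/-- A quadratic form is bounded on the unit sphere of a positive definite one. -/
lemma exists_dotProduct_mulVec_le {h : Matrix (Fin n) (Fin n) ℝ} (hh : h.PosDef)
    (Q : Matrix (Fin n) (Fin n) ℝ) :
    ∃ C : ℝ, ∀ v : Fin n → ℝ, v ⬝ᵥ h *ᵥ v = 1 → v ⬝ᵥ Q *ᵥ v ≤ C := by
  obtain ⟨B, rfl⟩ := hh.posSemidef.exists_eq_transpose_mul_self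
  have hB : IsUnit B.det := by
    have h1 := hh.det_pos
    rw [det_mul, det_transpose] at h1
    exact isUnit_iff_ne_zero.mpr fun h0 => by simp [h0] at h1
  refine ⟨∑ i, ∑ j, |(B⁻¹ᵀ * Q * B⁻¹) i j|, fun v hv => ?_⟩
  rw [dotProduct_transpose_mul_self_mulVec] at hv
  set u := B *ᵥ v with hu
  have hvu : v = B⁻¹ *ᵥ u := by rw [hu, mulVec_mulVec, nonsing_inv_mul _ hB, one_mulVec]
  have hle : ∀ i, |u i| ≤ 1 := fun i => by
    have h1 : u i * u i ≤ u ⬝ᵥ u :=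
      Finset.single_le_sum (f := fun i => u i * u i) (fun j _ => mul_self_nonneg _)
        (Finset.mem_univ i)
    exact abs_le_one_iff_mul_self_le_one.mpr (h1.trans hv.le)
  have hQ : v ⬝ᵥ Q *ᵥ v = u ⬝ᵥ (B⁻¹ᵀ * Q * B⁻¹) *ᵥ u := by
    rw [hvu, ← mulVec_mulVec, ← mulVec_mulVec, dotProduct_mulVec u, vecMul_transpose]
  rw [hQ]
  simp only [dotProduct, mulVec, Finset.mul_sum]
  refine Finset.sum_le_sum fun i _ => Finset.sum_le_sum fun j _ => ?_
  calc u i * ((B⁻¹ᵀ * Q * B⁻¹) i j * u j)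
      ≤ |u i * ((B⁻¹ᵀ * Q * B⁻¹) i j * u j)| := le_abs_self _
    _ = |u i| * |u j| * |(B⁻¹ᵀ * Q * B⁻¹) i j| := by rw [abs_mul, abs_mul]; ring
    _ ≤ 1 * |(B⁻¹ᵀ * Q * B⁻¹) i j| :=
        mul_le_mul_of_nonneg_right (mul_le_one₀ (hle i) (abs_nonneg _) (hle j)) (abs_nonneg _)
    _ = _ := one_mul _

variable {Φ : (Fin n → ℝ) → ℝ} {x : Fin n → ℝ}

lemma dotProduct_mulVec_le_hnorm (hh : (hess Φ x).PosDef) (Q : Fin n → Fin n → ℝ) (v : Fin n → ℝ)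
    (hv : v ⬝ᵥ hess Φ x *ᵥ v = 1) : v ⬝ᵥ (Matrix.of Q) *ᵥ v ≤ hnorm Φ Q x := by
  obtain ⟨C, hC⟩ := exists_dotProduct_mulVec_le hh (Matrix.of Q)
  refine le_csSup ⟨C, ?_⟩ ⟨v, ?_, ?_⟩
  · rintro r ⟨w, hw, rfl⟩
    rw [sum_sum_mul_mul_eq_dotProduct] at hw ⊢
    exact hC w hw
  · rw [sum_sum_mul_mul_eq_dotProduct]
    exact hv
  · rw [sum_sum_mul_mul_eq_dotProduct]

/-- A vector attaining the `h`-norm of a symmetric form is an eigenvector relative to `h`. -/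
lemma mulVec_eq_hnorm_smul (hh : (hess Φ x).PosDef) (Q : Fin n → Fin n → ℝ)
    (hQ : (Matrix.of Q)ᵀ = Matrix.of Q) (v : Fin n → ℝ) (hv : v ⬝ᵥ hess Φ x *ᵥ v = 1)
    (hmax : v ⬝ᵥ (Matrix.of Q) *ᵥ v = hnorm Φ Q x) :
    (Matrix.of Q) *ᵥ v = hnorm Φ Q x • hess Φ x *ᵥ v := by
  set l := hnorm Φ Q x with hl
  have hher : (l • hess Φ x - Matrix.of Q).IsHermitian := by
    have h1 : (hess Φ x)ᵀ = hess Φ x := by simpa using hh.isHermitian.eq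
    rw [IsHermitian, conjTranspose_eq_transpose_of_trivial, transpose_sub, transpose_smul, h1, hQ]
  have hpsd : (l • hess Φ x - Matrix.of Q).PosSemidef := by
    refine PosSemidef.of_dotProduct_mulVec_nonneg hher fun w => ?_
    simp only [star_trivial, sub_mulVec, smul_mulVec, dotProduct_sub, dotProduct_smul, smul_eq_mul]
    by_cases hw : w = 0
    · simp [hw]
    have hpos : 0 < w ⬝ᵥ hess Φ x *ᵥ w := by simpa using hh.dotProduct_mulVec_pos hw
    set s := w ⬝ᵥ hess Φ x *ᵥ w with hs
    have hsq : (√s)⁻¹ * (√s)⁻¹ = s⁻¹ := by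
      rw [← mul_inv, Real.mul_self_sqrt hpos.le]
    have h1 := dotProduct_mulVec_le_hnorm hh Q ((√s)⁻¹ • w) (by
      simp only [mulVec_smul, dotProduct_smul, smul_dotProduct, smul_eq_mul]
      rw [← mul_assoc, hsq, ← hs, inv_mul_cancel₀ hpos.ne'])
    simp only [mulVec_smul, dotProduct_smul, smul_dotProduct, smul_eq_mul] at h1
    rw [← mul_assoc, hsq, ← hl, inv_mul_le_iff₀ hpos] at h1
    linarith
  have h0 : (l • hess Φ x - Matrix.of Q) *ᵥ v = 0 := by
    rw [← hpsd.dotProduct_mulVec_zero_iff]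
    simp only [star_trivial, sub_mulVec, smul_mulVec, dotProduct_sub, dotProduct_smul, smul_eq_mul]
    rw [hv, hmax]
    ring
  rw [sub_mulVec, smul_mulVec, sub_eq_zero] at h0
  exact h0.symm

end HNorm

/-! ### Determinants and inverses of matrix fields -/

section Determinant

open Matrix

variable {n : ℕ} {x w : Fin n → ℝ} {Ω : Set (Fin n → ℝ)}

lemma contDiffOn_det {M : (Fin n → ℝ) → Matrix (Fin n) (Fin n) ℝ} {k : ℕ}
    (hM : ∀ a b, ContDiffOn ℝ k (fun y => M y a b) Ω) :
    ContDiffOn ℝ k (fun y => (M y).det) Ω := by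
  simp only [det_apply']
  exact ContDiffOn.sum fun σ _ => contDiffOn_const.mul (contDiffOn_prod fun i _ => hM _ _)

lemma contDiffOn_inv_apply {M : (Fin n → ℝ) → Matrix (Fin n) (Fin n) ℝ} {k : ℕ}
    (hM : ∀ a b, ContDiffOn ℝ k (fun y => M y a b) Ω) (hd : ∀ y ∈ Ω, (M y).det ≠ 0)
    (a b : Fin n) : ContDiffOn ℝ k (fun y => (M y)⁻¹ a b) Ω := by
  simp only [inv_def, Matrix.smul_apply, smul_eq_mul, Ring.inverse_eq_inv', adjugate_apply]
  refine ((contDiffOn_det hM).inv hd).mul (contDiffOn_det fun i j => ?_)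
  rcases eq_or_ne i b with rfl | hi
  · simpa only [updateRow_self] using contDiffOn_const
  · simpa only [updateRow_ne hi] using hM i j

lemma HasDirDeriv.prod {f : Fin n → (Fin n → ℝ) → ℝ} {d : Fin n → ℝ}
    (h : ∀ i, HasDirDeriv (f i) x w (d i)) :
    HasDirDeriv (fun y => ∏ i, f i y) x w
      (∑ i, ∏ j, Function.update (fun j => f j x) i (d i) j) := by
  have h1 := HasFDerivAt.finsetProd (u := Finset.univ) fun i _ => (h i).1.hasFDerivAt
  refine ⟨h1.differentiableAt, ?_⟩
  rw [h1.fderiv, _root_.sum_apply]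
  refine Finset.sum_congr rfl fun i _ => ?_
  rw [Finset.prod_update_of_mem (Finset.mem_univ i), Finset.sdiff_singleton_eq_erase]
  simp [(h i).2, mul_comm]

/-- Jacobi's formula. -/
lemma HasMatDeriv.det {M : (Fin n → ℝ) → Matrix (Fin n) (Fin n) ℝ}
    {D : Matrix (Fin n) (Fin n) ℝ} (hM : HasMatDeriv M x w D) :
    HasDirDeriv (fun y => (M y).det) x w ((M x).adjugate * D).trace := by
  have h1 : HasDirDeriv (fun y => (M y).det) x w (∑ σ : Equiv.Perm (Fin n),
      ((Equiv.Perm.sign σ : ℤ) : ℝ) *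
        ∑ i, ∏ j, Function.update (fun j => M x (σ j) j) i (D (σ i) i) j) := by
    simp only [det_apply']
    exact HasDirDeriv.sum fun σ _ => (HasDirDeriv.prod fun i => hM (σ i) i).const_mul _
  convert h1 using 1
  simp only [Finset.mul_sum]
  rw [Finset.sum_comm, Matrix.trace]
  refine Finset.sum_congr rfl fun i _ => ?_
  have h2 : ((M x).adjugate * D) i i = ((M x).adjugate *ᵥ fun k => D k i) i := by
    simp [mul_apply, mulVec, dotProduct]
  rw [diag_apply, h2, ← cramer_eq_adjugate_mulVec, cramer_apply, det_apply']
  refine Finset.sum_congr rfl fun σ _ => ?_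
  congr 1
  refine Finset.prod_congr rfl fun j _ => ?_
  rcases eq_or_ne j i with rfl | hj
  · simp
  · simp [updateCol_ne hj, Function.update_of_ne hj]

end Determinant

/-! ### The derivatives of the potential as matrix fields -/

section Fields

open Matrix

variable {n : ℕ}

/-- The matrix `f_{i··}` of third derivatives. -/
def thirdMat (f : (Fin n → ℝ) → ℝ) (i : Fin n) (x : Fin n → ℝ) : Matrix (Fin n) (Fin n) ℝ :=
  Matrix.of fun a b => pd3 f i a b x

/-- The matrix `f_{ij··}` of fourth derivatives. -/
def fourthMat (f : (Fin n → ℝ) → ℝ) (i j : Fin n) (x : Fin n → ℝ) : Matrix (Fin n) (Fin n) ℝ :=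
  Matrix.of fun a b => pd4 f i j a b x

/-- The matrix `f_{ij··k}` of fifth derivatives. -/
def fifthMat (f : (Fin n → ℝ) → ℝ) (i j k : Fin n) (x : Fin n → ℝ) :
    Matrix (Fin n) (Fin n) ℝ :=
  Matrix.of fun a b => pd5 f i j a b k x

/-- The matrix of second derivatives of `W` at `∇Φ(x)`. -/
def hessAtGrad (Φ W : (Fin n → ℝ) → ℝ) (x : Fin n → ℝ) : Matrix (Fin n) (Fin n) ℝ :=
  Matrix.of fun a b => pd2 W a b (grad Φ x)

/-- The matrix `Ŵ_{ij}`. -/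
def WhatMat (Φ W : (Fin n → ℝ) → ℝ) (x : Fin n → ℝ) : Matrix (Fin n) (Fin n) ℝ :=
  Matrix.of fun i j => What2 Φ W i j x

/-- The Calabi tensor as a matrix. -/
def calabiMat (Φ : (Fin n → ℝ) → ℝ) (x : Fin n → ℝ) : Matrix (Fin n) (Fin n) ℝ :=
  Matrix.of fun i j => calabi Φ i j x

section Smooth

variable {f : (Fin n → ℝ) → ℝ} {Ω : Set (Fin n → ℝ)} (hΩ : IsOpen Ω) {k : ℕ}
  (hf : ContDiffOn ℝ k f Ω) {x w : Fin n → ℝ} (hx : x ∈ Ω)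

include hΩ hf hx

lemma hess_transpose (hk : 2 ≤ k) : (hess f x)ᵀ = hess f x := by
  ext a b
  exact pd2_comm hΩ hf hk hx b a

lemma thirdMat_transpose (hk : 3 ≤ k) (i : Fin n) : (thirdMat f i x)ᵀ = thirdMat f i x := by
  ext a b
  exact pd3_comm_right hΩ hf hk hx i b a

lemma thirdMat_swap_left (hk : 3 ≤ k) (i a b : Fin n) :
    thirdMat f i x a b = thirdMat f a x i b := pd3_comm_left hΩ hf hk hx i a b

lemma thirdMat_swap_right (hk : 3 ≤ k) (i a b : Fin n) :
    thirdMat f i x a b = thirdMat f b x a i :=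
  (pd3_rotate hΩ hf hk hx i a b).trans (pd3_comm_right hΩ hf hk hx b i a)

lemma fourthMat_comm (hk : 4 ≤ k) (i j : Fin n) : fourthMat f i j x = fourthMat f j i x := by
  ext a b
  exact pd4_comm_left hΩ hf hk hx i j a b

lemma fourthMat_transpose (hk : 4 ≤ k) (i j : Fin n) :
    (fourthMat f i j x)ᵀ = fourthMat f i j x := by
  ext a b
  exact pd4_comm_right hΩ hf hk hx i j b a

lemma fourthMat_swap_right (hk : 4 ≤ k) (i j a b : Fin n) :
    fourthMat f i j x a b = fourthMat f i b x a j := by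
  change pd4 f i j a b x = pd4 f i b a j x
  rw [pd4_comm_mid hΩ hf hk hx, pd4_comm_right hΩ hf hk hx, pd4_comm_mid hΩ hf hk hx]

/-- The two pairs of indices of the fourth derivatives may be exchanged. -/
lemma fourthMat_swap_pairs (hk : 4 ≤ k) (i j a b : Fin n) :
    fourthMat f i j x a b = fourthMat f a b x i j := by
  change pd4 f i j a b x = pd4 f a b i j x
  rw [pd4_comm_mid hΩ hf hk hx, pd4_comm_left hΩ hf hk hx, pd4_comm_right hΩ hf hk hx,
    pd4_comm_mid hΩ hf hk hx]

lemma fifthMat_comm_left (hk : 5 ≤ k) (i j l : Fin n) :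
    fifthMat f i j l x = fifthMat f j i l x := by
  ext a b
  exact pd_congr hΩ (fun _ hy => pd4_comm_left hΩ hf (by omega) hy i j a b) l hx

lemma fifthMat_comm_right (hk : 5 ≤ k) (i j l : Fin n) :
    fifthMat f i j l x = fifthMat f i l j x := by
  have h : ∀ j l a b, pd5 f i j a b l x = pd2 (pd3 f i a b) j l x := fun j l a b =>
    pd_congr hΩ (fun _ hy => (pd4_comm_mid hΩ hf (by omega) hy i j a b).trans
      (pd4_comm_right hΩ hf (by omega) hy i a j b)) l hx
  have h3 : ∀ a b, ContDiffOn ℝ ((k - 3 : ℕ) : ℕ) (pd3 f i a b) Ω := fun a b =>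
    ((hf.pd hΩ (m := k - 1) (by omega) i).pd hΩ (m := k - 2) (by omega) a).pd hΩ
      (m := k - 3) (by omega) b
  ext a b
  change pd5 f i j a b l x = pd5 f i l a b j x
  rw [h, h, pd2_comm hΩ (h3 a b) (by omega) hx]

lemma fifthMat_reverse (hk : 5 ≤ k) (i j l : Fin n) :
    fifthMat f i j l x = fifthMat f l j i x := by
  rw [fifthMat_comm_left hΩ hf hx hk, fifthMat_comm_right hΩ hf hx hk,
    fifthMat_comm_left hΩ hf hx hk]

lemma hasMatDeriv_hess_single (hk : 3 ≤ k) (p : Fin n) :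
    HasMatDeriv (hess f) x (Pi.single p 1) (thirdMat f p x) := fun a b =>
  ⟨((hf.pd hΩ (m := k - 1) (by omega) a).pd hΩ (m := k - 2) (by omega)
    b).differentiableAt_of_isOpen hΩ (by omega) hx, pd3_rotate hΩ hf hk hx a b p⟩

lemma hasMatDeriv_hess (hk : 3 ≤ k) :
    HasMatDeriv (hess f) x w (∑ i, w i • thirdMat f i x) :=
  HasMatDeriv.of_single fun p => hasMatDeriv_hess_single hΩ hf hx hk p

lemma hasMatDeriv_thirdMat_single (hk : 4 ≤ k) (i p : Fin n) :
    HasMatDeriv (thirdMat f i) x (Pi.single p 1) (fourthMat f i p x) := fun a b =>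
  ⟨(((hf.pd hΩ (m := k - 1) (by omega) i).pd hΩ (m := k - 2) (by omega)
    a).pd hΩ (m := k - 3) (by omega) b).differentiableAt_of_isOpen hΩ (by omega) hx,
    (pd4_comm_right hΩ hf hk hx i a b p).trans (pd4_comm_mid hΩ hf hk hx i a p b)⟩

lemma hasMatDeriv_thirdMat (hk : 4 ≤ k) (i : Fin n) :
    HasMatDeriv (thirdMat f i) x w (∑ p, w p • fourthMat f p i x) := by
  simp only [fourthMat_comm hΩ hf hx hk _ i]
  exact HasMatDeriv.of_single fun p => hasMatDeriv_thirdMat_single hΩ hf hx hk i p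

lemma hasMatDeriv_fourthMat_single (hk : 5 ≤ k) (i j p : Fin n) :
    HasMatDeriv (fourthMat f i j) x (Pi.single p 1) (fifthMat f i j p x) := fun a b =>
  ⟨((((hf.pd hΩ (m := k - 1) (by omega) i).pd hΩ (m := k - 2) (by omega)
    j).pd hΩ (m := k - 3) (by omega) a).pd hΩ (m := k - 4) (by omega)
    b).differentiableAt_of_isOpen hΩ (by omega) hx, rfl⟩

lemma hasMatDeriv_fourthMat (hk : 5 ≤ k) (i j : Fin n) :
    HasMatDeriv (fourthMat f i j) x w (∑ p, w p • fifthMat f p j i x) := by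
  simp only [← fifthMat_reverse hΩ hf hx hk i j]
  exact HasMatDeriv.of_single fun p => hasMatDeriv_fourthMat_single hΩ hf hx hk i j p

/-- The chain rule for a composition with the gradient. -/
lemma hasDirDeriv_comp_grad (hk : 2 ≤ k) {F : (Fin n → ℝ) → ℝ} (hF : Differentiable ℝ F) :
    HasDirDeriv (fun y => F (grad f y)) x w (∑ l, (hess f x *ᵥ w) l * pd F l (grad f x)) := by
  have h1 : HasFDerivAt (grad f) (ContinuousLinearMap.pi fun i => fderiv ℝ (pd f i) x) x :=
    hasFDerivAt_pi.mpr fun i => ((hf.pd hΩ (m := k - 1) (by omega) i).differentiableAt_of_isOpen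
      hΩ (by omega) hx).hasFDerivAt
  have h2 := (hF (grad f x)).hasFDerivAt.comp x h1
  refine ⟨h2.differentiableAt, ?_⟩
  change fderiv ℝ (F ∘ grad f) x w = _
  rw [h2.fderiv, ContinuousLinearMap.comp_apply, fderiv_eq_sum_pd]
  refine Finset.sum_congr rfl fun l _ => ?_
  congr 1
  rw [ContinuousLinearMap.pi_apply, fderiv_eq_sum_pd]
  exact Finset.sum_congr rfl fun i _ => mul_comm _ _

end Smooth

end Fields

/-! ### Differentiating the Monge–Ampère equation -/

section MongeAmpere

open Matrix

variable {n : ℕ}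

/-- The coordinate transport setting. -/
structure TransportSetting (Ω : Set (Fin n → ℝ)) (Φ V W : (Fin n → ℝ) → ℝ) : Prop where
  isOpen : IsOpen Ω
  potential : ContDiffOn ℝ (5 : ℕ) Φ Ω
  posDef : ∀ x ∈ Ω, (hess Φ x).PosDef
  source : ContDiffOn ℝ (3 : ℕ) V Ω
  target : ContDiff ℝ (3 : ℕ) W
  mongeAmpere : ∀ x ∈ Ω, Real.exp (-V x) = Real.exp (-W (grad Φ x)) * (hess Φ x).det

namespace TransportSetting

variable {Ω : Set (Fin n → ℝ)} {Φ V W : (Fin n → ℝ) → ℝ} (S : TransportSetting Ω Φ V W)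
  {x w : Fin n → ℝ} (hx : x ∈ Ω)

include S

lemma target_on : ContDiffOn ℝ (3 : ℕ) W Set.univ := S.target.contDiffOn

include hx

lemma hess_symm : (hess Φ x)ᵀ = hess Φ x :=
  hess_transpose S.isOpen S.potential hx (by norm_num)

lemma third_symm (i : Fin n) : (thirdMat Φ i x)ᵀ = thirdMat Φ i x :=
  thirdMat_transpose S.isOpen S.potential hx (by norm_num) i

lemma third_swap_left (i a b : Fin n) : thirdMat Φ i x a b = thirdMat Φ a x i b :=
  thirdMat_swap_left S.isOpen S.potential hx (by norm_num) i a b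

lemma third_swap_right (i a b : Fin n) : thirdMat Φ i x a b = thirdMat Φ b x a i :=
  thirdMat_swap_right S.isOpen S.potential hx (by norm_num) i a b

lemma ihess_posDef : (ihess Φ x).PosDef := (S.posDef x hx).inv

lemma ihess_symm : (ihess Φ x)ᵀ = ihess Φ x := by
  rw [ihess, transpose_nonsing_inv, S.hess_symm hx]

lemma isUnit_det : IsUnit (hess Φ x).det := (S.posDef x hx).det_pos.ne'.isUnit

lemma hess_mul_ihess : hess Φ x * ihess Φ x = 1 := mul_nonsing_inv _ (S.isUnit_det hx)

lemma ihess_mul_hess : ihess Φ x * hess Φ x = 1 := nonsing_inv_mul _ (S.isUnit_det hx)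

lemma hasMatDeriv_ihess {D : Matrix (Fin n) (Fin n) ℝ} (hD : HasMatDeriv (hess Φ) x w D) :
    HasMatDeriv (ihess Φ) x w (-(ihess Φ x * D * ihess Φ x)) := by
  refine hD.inv (Filter.eventually_of_mem (S.isOpen.mem_nhds hx) fun y hy => S.isUnit_det hy)
    fun a b => ?_
  refine (contDiffOn_inv_apply (k := 3) (fun a b => ?_) (fun y hy => (S.isUnit_det hy).ne_zero)
    a b).differentiableAt_of_isOpen S.isOpen (by norm_num) hx
  exact (S.potential.pd S.isOpen (m := 4) (by norm_num) a).pd S.isOpen (by norm_num) b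

lemma hasMatDeriv_ihess_single (p : Fin n) : HasMatDeriv (ihess Φ) x (Pi.single p 1)
    (-(ihess Φ x * thirdMat Φ p x * ihess Φ x)) :=
  S.hasMatDeriv_ihess hx (hasMatDeriv_hess_single S.isOpen S.potential hx (by norm_num) p)

lemma calabi_eq_trace (i j : Fin n) :
    calabi Φ i j x = (ihess Φ x * thirdMat Φ i x * ihess Φ x * thirdMat Φ j x).trace := by
  have hP : ∀ a b, ihess Φ x a b = ihess Φ x b a := fun a b =>
    congrFun (congrFun (S.ihess_symm hx).symm a) b
  have hT : ∀ a b, pd3 Φ j a b x = thirdMat Φ j x b a := fun a b =>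
    congrFun (congrFun (S.third_symm hx j).symm a) b
  simp only [calabi, trace, diag_apply, mul_apply, Finset.sum_mul, hT]
  rw [Finset.sum_comm]
  refine (Finset.sum_congr rfl fun b _ => Finset.sum_comm).trans ?_
  rw [Finset.sum_comm]
  refine Finset.sum_congr rfl fun c _ => ?_
  rw [Finset.sum_comm]
  refine (Finset.sum_congr rfl fun a _ => Finset.sum_comm).trans ?_
  rw [Finset.sum_comm]
  refine Finset.sum_congr rfl fun d _ => ?_
  rw [Finset.sum_comm]
  refine Finset.sum_congr rfl fun b _ => Finset.sum_congr rfl fun a _ => ?_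
  rw [hP a c]
  simp only [thirdMat, of_apply]
  ring

lemma calabiMat_symm : (calabiMat Φ x)ᵀ = calabiMat Φ x := by
  ext i j
  simp only [calabiMat, transpose_apply, of_apply, S.calabi_eq_trace hx]
  simpa only [Matrix.mul_assoc] using
    trace_mul_comm (ihess Φ x * thirdMat Φ j x) (ihess Φ x * thirdMat Φ i x)

/-- The Calabi tensor as a contraction of matrix products. -/
lemma calabiMat_eq_sum : calabiMat Φ x =
    ∑ p, ∑ q, ihess Φ x p q • (thirdMat Φ p x * ihess Φ x * thirdMat Φ q x) := by
  ext i j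
  rw [sum_sum_smul_mul_mul_apply (S.ihess_symm hx) (S.third_swap_left hx)
    (S.third_swap_right hx), ← S.calabi_eq_trace hx]
  rfl

/-- The first derivative of the Monge–Ampère equation. -/
lemma pd_source (i : Fin n) : pd V i x =
    ∑ l, Wop Φ W l x * hess Φ x l i - (ihess Φ x * thirdMat Φ i x).trace := by
  have hlog : ∀ y ∈ Ω, W (grad Φ y) - V y = Real.log (hess Φ y).det := fun y hy => by
    have h1 : (hess Φ y).det = Real.exp (W (grad Φ y) - V y) := by
      rw [sub_eq_add_neg, Real.exp_add, S.mongeAmpere y hy, ← mul_assoc, ← Real.exp_add]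
      simp
    rw [h1, Real.log_exp]
  have hdet := (hasMatDeriv_hess_single S.isOpen S.potential hx (by norm_num) i).det
  have h1 : HasDirDeriv (fun y => Real.log (hess Φ y).det) x (Pi.single i 1)
      (ihess Φ x * thirdMat Φ i x).trace := by
    refine ⟨hdet.1.log (S.isUnit_det hx).ne_zero, ?_⟩
    rw [fderiv.log hdet.1 (S.isUnit_det hx).ne_zero]
    simp [hdet.2, ihess, inv_def]
  have h2 := ((hasDirDeriv_comp_grad S.isOpen S.potential hx (by norm_num) (w := Pi.single i 1)
    (S.target.differentiable (by norm_num))).sub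
    (HasDirDeriv.of_differentiableAt (w := Pi.single i 1)
      (S.source.differentiableAt_of_isOpen S.isOpen (by norm_num) hx))).congr
    (Filter.eventually_of_mem (S.isOpen.mem_nhds hx) hlog)
  have h3 := h1.unique h2
  rw [h3]
  simp [Wop, Pi.single_apply, mul_comm]

omit hx in
lemma differentiable_pd_target (l : Fin n) : Differentiable ℝ (pd W l) := fun y =>
  (S.target_on.pd isOpen_univ (m := 2) (by norm_num) l).differentiableAt_of_isOpen isOpen_univ
    (by norm_num) (Set.mem_univ y)

omit hx in
lemma differentiable_pd2_target (l m : Fin n) : Differentiable ℝ (pd2 W l m) := fun y =>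
  ((S.target_on.pd isOpen_univ (m := 2) (by norm_num) l).pd isOpen_univ (m := 1) (by norm_num)
    m).differentiableAt_of_isOpen isOpen_univ (by norm_num) (Set.mem_univ y)

lemma hasDirDeriv_Wop (l : Fin n) :
    HasDirDeriv (Wop Φ W l) x w ((hessAtGrad Φ W x *ᵥ hess Φ x *ᵥ w) l) := by
  have h : HasDirDeriv (Wop Φ W l) x w _ := hasDirDeriv_comp_grad S.isOpen S.potential hx
    (by norm_num) (S.differentiable_pd_target l)
  convert h using 1
  change ∑ m, hessAtGrad Φ W x l m * (hess Φ x *ᵥ w) m = _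
  exact Finset.sum_congr rfl fun m _ => mul_comm _ _

lemma WhatMat_eq : WhatMat Φ W x = hess Φ x * hessAtGrad Φ W x * hess Φ x := by
  have hs : ∀ a b, hess Φ x a b = hess Φ x b a := fun a b =>
    congrFun (congrFun (S.hess_symm hx).symm a) b
  ext i j
  simp only [WhatMat, What2, of_apply, mul_apply, Finset.sum_mul]
  rw [Finset.sum_comm]
  refine Finset.sum_congr rfl fun b _ => Finset.sum_congr rfl fun a _ => ?_
  rw [hs i a]
  simp only [hess, hessAtGrad, of_apply]
  ring

/-- The second derivative of the Monge–Ampère equation. -/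
lemma hess_source : hess V x = WhatMat Φ W x + ∑ l, Wop Φ W l x • thirdMat Φ l x
    + calabiMat Φ x - ∑ p, ∑ q, ihess Φ x p q • fourthMat Φ p q x := by
  ext i j
  have h1 : HasDirDeriv (pd V i) x (Pi.single j 1)
      (∑ l, ((hessAtGrad Φ W x *ᵥ hess Φ x *ᵥ Pi.single j 1) l * hess Φ x l i
        + Wop Φ W l x * thirdMat Φ j x l i)
      - (-(ihess Φ x * thirdMat Φ j x * ihess Φ x) * thirdMat Φ i x
        + ihess Φ x * fourthMat Φ i j x).trace) := by
    refine HasDirDeriv.congr ?_ (Filter.eventually_of_mem (S.isOpen.mem_nhds hx)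
      fun y hy => (S.pd_source hy i).symm)
    exact (HasDirDeriv.sum fun l _ => (S.hasDirDeriv_Wop hx l).mul
      (hasMatDeriv_hess_single S.isOpen S.potential hx (by norm_num) j l i)).sub
      ((S.hasMatDeriv_ihess_single hx j).mul
        (hasMatDeriv_thirdMat_single S.isOpen S.potential hx (by norm_num) i j)).trace
  have h2 : hess V x i j = _ := h1.pd_eq
  rw [h2, Finset.sum_add_distrib]
  have hs : ∀ a b, hess Φ x a b = hess Φ x b a := fun a b =>
    congrFun (congrFun (S.hess_symm hx).symm a) b
  have e1 : ∑ l, (hessAtGrad Φ W x *ᵥ hess Φ x *ᵥ Pi.single j 1) l * hess Φ x l i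
      = WhatMat Φ W x i j := by
    rw [S.WhatMat_eq hx, Matrix.mul_assoc, mul_apply]
    refine Finset.sum_congr rfl fun l _ => ?_
    rw [mulVec_mulVec, mulVec_single_one, hs l i, mul_comm]
    rfl
  have e2 : ∑ l, Wop Φ W l x * thirdMat Φ j x l i
      = (∑ l, Wop Φ W l x • thirdMat Φ l x) i j := by
    rw [Matrix.sum_apply]
    refine Finset.sum_congr rfl fun l _ => ?_
    rw [S.third_swap_left hx, Matrix.smul_apply, smul_eq_mul, S.third_swap_right hx l i j,
      S.third_swap_left hx j i l, S.third_swap_right hx i j l]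
  have e3 : (ihess Φ x * fourthMat Φ i j x).trace
      = (∑ p, ∑ q, ihess Φ x p q • fourthMat Φ p q x) i j := by
    simp only [Matrix.sum_apply, trace, diag_apply, mul_apply, Matrix.smul_apply, smul_eq_mul]
    refine Finset.sum_congr rfl fun p _ => Finset.sum_congr rfl fun q _ => ?_
    rw [fourthMat_swap_pairs S.isOpen S.potential hx (by norm_num) i j q p,
      fourthMat_comm S.isOpen S.potential hx (by norm_num) q p]
  have e4 : (ihess Φ x * thirdMat Φ j x * ihess Φ x * thirdMat Φ i x).trace
      = calabiMat Φ x i j := by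
    rw [← S.calabi_eq_trace hx, ← S.calabiMat_symm hx]
    rfl
  rw [e1, e2, trace_add, neg_mul, trace_neg, e3, e4]
  simp only [Matrix.add_apply, Matrix.sub_apply]
  ring

end TransportSetting

end MongeAmpere

/-! ### Derivatives in a fixed direction -/

section Directional

open Matrix

variable {n : ℕ}

/-- The directional derivative `∂_v D²Φ`. -/
def thirdDir (Φ : (Fin n → ℝ) → ℝ) (v x : Fin n → ℝ) : Matrix (Fin n) (Fin n) ℝ :=
  ∑ i, v i • thirdMat Φ i x

/-- The directional derivative `∂_v ∂_p D²Φ`. -/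
def fourthDir (Φ : (Fin n → ℝ) → ℝ) (v : Fin n → ℝ) (p : Fin n) (x : Fin n → ℝ) :
    Matrix (Fin n) (Fin n) ℝ :=
  ∑ i, v i • fourthMat Φ i p x

/-- The directional derivative `∂_v ∂_q ∂_p D²Φ`. -/
def fifthDir (Φ : (Fin n → ℝ) → ℝ) (v : Fin n → ℝ) (q p : Fin n) (x : Fin n → ℝ) :
    Matrix (Fin n) (Fin n) ℝ :=
  ∑ i, v i • fifthMat Φ i q p x

/-- The matrix `(∂_l D²W)(∇Φ(x))`. -/
def thirdAtGrad (Φ W : (Fin n → ℝ) → ℝ) (l : Fin n) (x : Fin n → ℝ) :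
    Matrix (Fin n) (Fin n) ℝ :=
  thirdMat W l (grad Φ x)

/-- The derivative of the Calabi tensor when `∂D²Φ = D` and `∂Φ_{i··} = E_i`. -/
def calabiVariation (P D : Matrix (Fin n) (Fin n) ℝ) (T E : Fin n → Matrix (Fin n) (Fin n) ℝ) :
    Matrix (Fin n) (Fin n) ℝ :=
  Matrix.of fun i j => (P * E i * P * T j).trace + (P * T i * P * E j).trace
    - (P * D * P * T i * P * T j).trace - (P * T i * P * D * P * T j).trace

namespace TransportSetting

variable {Ω : Set (Fin n → ℝ)} {Φ V W : (Fin n → ℝ) → ℝ} (S : TransportSetting Ω Φ V W)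
  {x w v : Fin n → ℝ} (hx : x ∈ Ω)

include S hx

lemma thirdDir_symm : (thirdDir Φ v x)ᵀ = thirdDir Φ v x := by
  simp only [thirdDir, transpose_sum, transpose_smul, S.third_symm hx]

lemma fourthDir_symm (p : Fin n) : (fourthDir Φ v p x)ᵀ = fourthDir Φ v p x := by
  simp only [fourthDir, transpose_sum, transpose_smul,
    fourthMat_transpose S.isOpen S.potential hx (by norm_num)]

lemma fourthDir_swap_right (p a b : Fin n) :
    fourthDir Φ v p x a b = fourthDir Φ v b x a p := by
  simp only [fourthDir, Matrix.sum_apply, Matrix.smul_apply,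
    fourthMat_swap_right S.isOpen S.potential hx (by norm_num) _ p a b]

lemma hasMatDeriv_thirdDir (p : Fin n) :
    HasMatDeriv (thirdDir Φ v) x (Pi.single p 1) (fourthDir Φ v p x) :=
  HasMatDeriv.sum fun i _ =>
    (hasMatDeriv_thirdMat_single S.isOpen S.potential hx (by norm_num) i p).const_smul (v i)

lemma hasMatDeriv_fourthDir (q p : Fin n) :
    HasMatDeriv (fourthDir Φ v q) x (Pi.single p 1) (fifthDir Φ v q p x) :=
  HasMatDeriv.sum fun i _ =>
    (hasMatDeriv_fourthMat_single S.isOpen S.potential hx (by norm_num) i q p).const_smul (v i)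

lemma hasMatDeriv_ihess_dir :
    HasMatDeriv (ihess Φ) x v (-(ihess Φ x * thirdDir Φ v x * ihess Φ x)) :=
  S.hasMatDeriv_ihess hx (hasMatDeriv_hess S.isOpen S.potential hx (by norm_num))

lemma hasMatDeriv_calabiMat {D : Matrix (Fin n) (Fin n) ℝ} {E : Fin n → Matrix (Fin n) (Fin n) ℝ}
    (hD : HasMatDeriv (hess Φ) x w D) (hE : ∀ i, HasMatDeriv (thirdMat Φ i) x w (E i)) :
    HasMatDeriv (calabiMat Φ) x w
      (calabiVariation (ihess Φ x) D (fun i => thirdMat Φ i x) E) := by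
  intro i j
  have hP := S.hasMatDeriv_ihess hx hD
  have h : HasDirDeriv (fun y => calabiMat Φ y i j) x w _ :=
    (((hP.mul (hE i)).mul hP).mul (hE j)).trace.congr
    (Filter.eventually_of_mem (S.isOpen.mem_nhds hx) fun y hy => (S.calabi_eq_trace hy i j).symm)
  convert h using 1
  simp only [calabiVariation, of_apply, Matrix.add_mul, trace_add, Matrix.neg_mul, Matrix.mul_neg,
    trace_neg, Matrix.mul_assoc]
  ring

lemma hasMatDeriv_calabiMat_single (q : Fin n) :
    HasMatDeriv (calabiMat Φ) x (Pi.single q 1) (calabiVariation (ihess Φ x) (thirdMat Φ q x)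
      (fun i => thirdMat Φ i x) fun i => fourthMat Φ i q x) :=
  S.hasMatDeriv_calabiMat hx (hasMatDeriv_hess_single S.isOpen S.potential hx (by norm_num) q)
    fun i => hasMatDeriv_thirdMat_single S.isOpen S.potential hx (by norm_num) i q

lemma hasMatDeriv_calabiMat_dir :
    HasMatDeriv (calabiMat Φ) x v (calabiVariation (ihess Φ x) (thirdDir Φ v x)
      (fun i => thirdMat Φ i x) fun i => fourthDir Φ v i x) :=
  S.hasMatDeriv_calabiMat hx (hasMatDeriv_hess S.isOpen S.potential hx (by norm_num))
    fun i => hasMatDeriv_thirdMat S.isOpen S.potential hx (by norm_num) i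

lemma hasMatDeriv_hessAtGrad : HasMatDeriv (hessAtGrad Φ W) x v
    (∑ l, (hess Φ x *ᵥ v) l • thirdAtGrad Φ W l x) := by
  intro a b
  have h : HasDirDeriv (fun y => hessAtGrad Φ W y a b) x v _ :=
    hasDirDeriv_comp_grad S.isOpen S.potential hx (by norm_num) (S.differentiable_pd2_target a b)
  convert h using 1
  rw [Matrix.sum_apply]
  refine Finset.sum_congr rfl fun l _ => ?_
  rw [Matrix.smul_apply, smul_eq_mul]
  congr 1
  exact (pd3_rotate isOpen_univ S.target_on (by norm_num) (Set.mem_univ _) a b l).symm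

lemma sum_smul_What3 : ∑ i, v i • Matrix.of (fun a b => What3 Φ W i a b x) =
    hess Φ x * (∑ l, (hess Φ x *ᵥ v) l • thirdAtGrad Φ W l x) * hess Φ x := by
  have hs : ∀ a b, hess Φ x a b = hess Φ x b a := fun a b =>
    congrFun (congrFun (S.hess_symm hx).symm a) b
  have h1 : ∀ i, Matrix.of (fun a b => What3 Φ W i a b x)
      = ∑ l, hess Φ x l i • (hess Φ x * thirdAtGrad Φ W l x * hess Φ x) := by
    intro i
    ext a b
    simp only [What3, of_apply, Matrix.sum_apply, Matrix.smul_apply, smul_eq_mul, mul_apply,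
      Finset.sum_mul, Finset.mul_sum]
    refine Finset.sum_congr rfl fun l _ => ?_
    rw [Finset.sum_comm]
    refine Finset.sum_congr rfl fun d _ => Finset.sum_congr rfl fun c _ => ?_
    rw [hs a c]
    simp only [hess, thirdAtGrad, thirdMat, of_apply]
    ring
  simp only [h1, Finset.smul_sum, Finset.mul_sum, Finset.sum_mul, Matrix.mul_smul,
    Matrix.smul_mul, smul_smul, mulVec, dotProduct, Finset.sum_smul]
  rw [Finset.sum_comm]
  exact Finset.sum_congr rfl fun l _ => Finset.sum_congr rfl fun i _ => by rw [mul_comm]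

lemma sum_smul_Smat : ∑ i, v i • Smat Φ V W i x = ∑ i, v i • thirdMat V i x
    - hess Φ x * (∑ l, (hess Φ x *ᵥ v) l • thirdAtGrad Φ W l x) * hess Φ x := by
  rw [← S.sum_smul_What3 hx, ← Finset.sum_sub_distrib]
  refine Finset.sum_congr rfl fun i _ => ?_
  rw [← smul_sub]
  rfl

lemma sum_smul_Smat_symm :
    (∑ i, v i • Smat Φ V W i x)ᵀ = ∑ i, v i • Smat Φ V W i x := by
  have hV : ∀ i, (thirdMat V i x)ᵀ = thirdMat V i x := fun i =>
    thirdMat_transpose S.isOpen S.source hx (by norm_num) i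
  have hW : ∀ l, (thirdAtGrad Φ W l x)ᵀ = thirdAtGrad Φ W l x := fun l =>
    thirdMat_transpose isOpen_univ S.target_on (Set.mem_univ _) (by norm_num) l
  rw [S.sum_smul_Smat hx]
  simp only [transpose_sub, transpose_mul, transpose_sum, transpose_smul, hV, hW, S.hess_symm hx,
    Matrix.mul_assoc]

/-- The third derivative of the Monge–Ampère equation. -/
lemma third_source : ∑ p, ∑ q, ihess Φ x p q • fifthDir Φ v q p x
      - ∑ l, Wop Φ W l x • fourthDir Φ v l x =
    ∑ p, ∑ q, (ihess Φ x * thirdDir Φ v x * ihess Φ x) p q • fourthMat Φ p q x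
      + ∑ l, (hessAtGrad Φ W x *ᵥ hess Φ x *ᵥ v) l • thirdMat Φ l x
      + (thirdDir Φ v x * hessAtGrad Φ W x * hess Φ x
        + hess Φ x * hessAtGrad Φ W x * thirdDir Φ v x)
      + calabiVariation (ihess Φ x) (thirdDir Φ v x) (fun i => thirdMat Φ i x)
        (fun i => fourthDir Φ v i x)
      - ∑ i, v i • Smat Φ V W i x := by
  have hh : HasMatDeriv (hess Φ) x v (thirdDir Φ v x) :=
    hasMatDeriv_hess S.isOpen S.potential hx (by norm_num)
  have hV : HasMatDeriv (hess V) x v (∑ i, v i • thirdMat V i x) :=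
    hasMatDeriv_hess S.isOpen S.source hx (by norm_num)
  have hW : HasMatDeriv (fun y => hess Φ y * hessAtGrad Φ W y * hess Φ y) x v _ :=
    (hh.mul (S.hasMatDeriv_hessAtGrad hx)).mul hh
  have hdrift : HasMatDeriv (fun y => ∑ l, Wop Φ W l y • thirdMat Φ l y) x v
      (∑ l, ((hessAtGrad Φ W x *ᵥ hess Φ x *ᵥ v) l • thirdMat Φ l x
        + Wop Φ W l x • fourthDir Φ v l x)) :=
    HasMatDeriv.sum fun l _ => (HasMatDeriv.smul (S.hasDirDeriv_Wop hx l)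
      (hasMatDeriv_thirdMat S.isOpen S.potential hx (by norm_num) l))
  have hfour : HasMatDeriv (fun y => ∑ p, ∑ q, ihess Φ y p q • fourthMat Φ p q y) x v
      (∑ p, ∑ q, ((-(ihess Φ x * thirdDir Φ v x * ihess Φ x)) p q • fourthMat Φ p q x
        + ihess Φ x p q • fifthDir Φ v q p x)) :=
    HasMatDeriv.sum fun p _ => HasMatDeriv.sum fun q _ =>
      HasMatDeriv.smul (S.hasMatDeriv_ihess_dir hx p q)
        (hasMatDeriv_fourthMat S.isOpen S.potential hx (by norm_num) p q)
  have key := hV.unique ((((hW.add hdrift).add (S.hasMatDeriv_calabiMat_dir hx)).sub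
    hfour).congr (Filter.eventually_of_mem (S.isOpen.mem_nhds hx) fun y hy => by
      simpa only [S.WhatMat_eq hy] using (S.hess_source hy).symm))
  rw [S.sum_smul_Smat hx, key]
  simp only [Finset.sum_add_distrib, Matrix.neg_apply, neg_smul, Finset.sum_neg_distrib,
    Matrix.add_mul]
  abel

end TransportSetting

end Directional

/-! ### The weighted Laplacian of a symmetric tensor contracted twice with a vector -/

section Laplacian

open Matrix

variable {n : ℕ}

/-- The covariant derivative `(∇T)_{p··}` as a matrix. -/
def covMat (Φ : (Fin n → ℝ) → ℝ) (T : Fin n → Fin n → (Fin n → ℝ) → ℝ) (p : Fin n)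
    (x : Fin n → ℝ) : Matrix (Fin n) (Fin n) ℝ :=
  Matrix.of fun i j => covD2 Φ T p i j x

/-- The derivative `∂_p (∇T)_{q··}` as a matrix. -/
def pdCovMat (Φ : (Fin n → ℝ) → ℝ) (T : Fin n → Fin n → (Fin n → ℝ) → ℝ) (p q : Fin n)
    (x : Fin n → ℝ) : Matrix (Fin n) (Fin n) ℝ :=
  Matrix.of fun i j => pd (covD2 Φ T q i j) p x

lemma HasMatDeriv.quadForm {M : (Fin n → ℝ) → Matrix (Fin n) (Fin n) ℝ} {x w : Fin n → ℝ}
    {D : Matrix (Fin n) (Fin n) ℝ} (hM : HasMatDeriv M x w D) (v : Fin n → ℝ) :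
    HasDirDeriv (fun y => v ⬝ᵥ M y *ᵥ v) x w (v ⬝ᵥ D *ᵥ v) := by
  simp only [dotProduct, mulVec, Finset.mul_sum]
  refine HasDirDeriv.sum fun i _ => HasDirDeriv.sum fun j _ => HasDirDeriv.const_mul _ ?_
  simpa only [mul_comm] using (hM i j).const_mul (v j)

namespace TransportSetting

variable {Ω : Set (Fin n → ℝ)} {Φ V W : (Fin n → ℝ) → ℝ} (S : TransportSetting Ω Φ V W)
  {x w v : Fin n → ℝ} (hx : x ∈ Ω)

include S hx

lemma Γh_eq (m p i : Fin n) : Γh Φ m p i x = 1 / 2 * (ihess Φ x * thirdMat Φ p x) m i := by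
  rw [Γh, mul_apply]
  congr 1
  refine Finset.sum_congr rfl fun k _ => ?_
  rw [S.third_swap_left hx]
  rfl

lemma sum_Γh_mul_left (M : Fin n → Fin n → ℝ) (p i j : Fin n) :
    ∑ m, Γh Φ m p i x * M m j = 1 / 2 * (thirdMat Φ p x * ihess Φ x * Matrix.of M) i j := by
  have h : thirdMat Φ p x * ihess Φ x = (ihess Φ x * thirdMat Φ p x)ᵀ := by
    rw [transpose_mul, S.ihess_symm hx, S.third_symm hx]
  rw [h, mul_apply, Finset.mul_sum]
  refine Finset.sum_congr rfl fun m _ => ?_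
  rw [S.Γh_eq hx, transpose_apply, of_apply, mul_assoc]

lemma sum_Γh_mul_right (M : Fin n → Fin n → ℝ) (p i j : Fin n) :
    ∑ m, Γh Φ m p j x * M i m = 1 / 2 * (Matrix.of M * ihess Φ x * thirdMat Φ p x) i j := by
  rw [Matrix.mul_assoc, mul_apply, Finset.mul_sum]
  refine Finset.sum_congr rfl fun m _ => ?_
  rw [S.Γh_eq hx, of_apply]
  ring

/-- The trace of the Christoffel symbols, from the Monge–Ampère equation. -/
lemma sum_ihess_mul_Γh (m : Fin n) : ∑ p, ∑ q, ihess Φ x p q * Γh Φ m p q x =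
    1 / 2 * (Wop Φ W m x - ∑ k, ihess Φ x m k * pd V k x) := by
  have hPs : ∀ a b, ihess Φ x a b = ihess Φ x b a := fun a b =>
    congrFun (congrFun (S.ihess_symm hx).symm a) b
  have h1 : ∑ p, ∑ q, ihess Φ x p q * Γh Φ m p q x
      = 1 / 2 * ∑ k, ihess Φ x m k * (ihess Φ x * thirdMat Φ k x).trace := by
    simp only [Γh, trace, diag_apply, mul_apply, Finset.mul_sum]
    refine (Finset.sum_congr rfl fun p _ => Finset.sum_comm).trans ?_
    rw [Finset.sum_comm]
    refine Finset.sum_congr rfl fun k _ => ?_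
    rw [Finset.sum_comm]
    refine Finset.sum_congr rfl fun q _ => Finset.sum_congr rfl fun p _ => ?_
    rw [hPs q p]
    simp only [thirdMat, of_apply]
    ring
  have h2 : ∀ k, (ihess Φ x * thirdMat Φ k x).trace
      = ∑ l, Wop Φ W l x * hess Φ x l k - pd V k x := fun k => by
    rw [S.pd_source hx]
    ring
  have h3 : ∑ k, ihess Φ x m k * ∑ l, Wop Φ W l x * hess Φ x l k = Wop Φ W m x := by
    have h4 : ∀ k, ∑ l, Wop Φ W l x * hess Φ x l k
        = (hess Φ x *ᵥ fun l => Wop Φ W l x) k := fun k => by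
      simp only [mulVec, dotProduct]
      refine Finset.sum_congr rfl fun l _ => ?_
      rw [mul_comm]
      congr 1
      exact congrFun (congrFun (S.hess_symm hx) k) l
    simp only [h4]
    change (ihess Φ x *ᵥ hess Φ x *ᵥ fun l => Wop Φ W l x) m = _
    rw [mulVec_mulVec, S.ihess_mul_hess hx, one_mulVec]
  rw [h1]
  simp only [h2, mul_sub, Finset.sum_sub_distrib, h3]

/-- The weighted Laplacian in matrix form; the drift cancels against the connection. -/
lemma LT2_eq (T : Fin n → Fin n → (Fin n → ℝ) → ℝ) :
    Matrix.of (fun i j => LT2 Φ V W T i j x) =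
      ∑ p, ∑ q, ihess Φ x p q • (pdCovMat Φ T p q x - (1 / 2 : ℝ) •
        (thirdMat Φ p x * ihess Φ x * covMat Φ T q x + covMat Φ T q x * ihess Φ x * thirdMat Φ p x))
      - ∑ m, Wop Φ W m x • covMat Φ T m x := by
  ext i j
  have h1 : ∀ p q, covD3 Φ (covD2 Φ T) p q i j x = (pdCovMat Φ T p q x - (1 / 2 : ℝ) •
        (thirdMat Φ p x * ihess Φ x * covMat Φ T q x
          + covMat Φ T q x * ihess Φ x * thirdMat Φ p x)) i j
      - ∑ m, Γh Φ m p q x * covD2 Φ T m i j x := fun p q => by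
    rw [covD3, S.sum_Γh_mul_left hx (fun a b => covD2 Φ T q a b x) p i j,
      S.sum_Γh_mul_right hx (fun a b => covD2 Φ T q a b x) p i j]
    simp only [pdCovMat, covMat, Matrix.sub_apply, Matrix.smul_apply, Matrix.add_apply, of_apply,
      smul_eq_mul]
    ring
  have h2 : ∑ p, ∑ q, ihess Φ x p q * ∑ m, Γh Φ m p q x * covD2 Φ T m i j x
      = ∑ m, (∑ p, ∑ q, ihess Φ x p q * Γh Φ m p q x) * covD2 Φ T m i j x := by
    simp only [Finset.mul_sum, Finset.sum_mul, mul_assoc]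
    refine (Finset.sum_congr rfl fun p _ => Finset.sum_comm).trans ?_
    rw [Finset.sum_comm]
  simp only [of_apply, LT2, h1, mul_sub, Finset.sum_sub_distrib, h2, S.sum_ihess_mul_Γh hx]
  rw [Matrix.sub_apply, sub_sub]
  congr 1
  · simp only [Matrix.sum_apply, Matrix.smul_apply, smul_eq_mul, Matrix.sub_apply, mul_sub,
      Finset.sum_sub_distrib]
  · simp only [Matrix.sum_apply, Matrix.smul_apply, smul_eq_mul, covMat, of_apply, Finset.mul_sum]
    rw [← Finset.sum_add_distrib]
    refine Finset.sum_congr rfl fun m _ => ?_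
    simp only [← Finset.mul_sum]
    ring

/-- The covariant derivative of the Calabi tensor. -/
lemma covMat_calabi (q : Fin n) : covMat Φ (calabi Φ) q x =
    calabiVariation (ihess Φ x) (thirdMat Φ q x) (fun i => thirdMat Φ i x)
        (fun i => fourthMat Φ i q x)
      - (1 / 2 : ℝ) • (thirdMat Φ q x * ihess Φ x * calabiMat Φ x
        + calabiMat Φ x * ihess Φ x * thirdMat Φ q x) := by
  ext i j
  have h1 : pd (calabi Φ i j) q x = _ := (S.hasMatDeriv_calabiMat_single hx q i j).pd_eq
  change covD2 Φ (calabi Φ) q i j x = _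
  rw [covD2, S.sum_Γh_mul_left hx (fun a b => calabi Φ a b x) q i j,
    S.sum_Γh_mul_right hx (fun a b => calabi Φ a b x) q i j, h1]
  simp only [calabiMat, Matrix.sub_apply, Matrix.smul_apply, Matrix.add_apply, smul_eq_mul]
  ring

/-- The first derivatives of `g(v,v)`. -/
lemma quadForm_calabiVariation (q : Fin n) :
    v ⬝ᵥ calabiVariation (ihess Φ x) (thirdMat Φ q x) (fun i => thirdMat Φ i x)
        (fun i => fourthMat Φ i q x) *ᵥ v =
      2 * (ihess Φ x * fourthDir Φ v q x * ihess Φ x * thirdDir Φ v x).trace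
      - 2 * (ihess Φ x * thirdMat Φ q x * ihess Φ x * thirdDir Φ v x * ihess Φ x
        * thirdDir Φ v x).trace := by
  have hu : ∀ y ∈ Ω, v ⬝ᵥ calabiMat Φ y *ᵥ v
      = (ihess Φ y * thirdDir Φ v y * ihess Φ y * thirdDir Φ v y).trace := fun y hy => by
    rw [calabiMat, ← sum_sum_mul_mul_eq_dotProduct]
    simp only [S.calabi_eq_trace hy, thirdDir, Finset.mul_sum, Finset.sum_mul, trace_sum,
      Matrix.mul_smul, Matrix.smul_mul, trace_smul, smul_eq_mul]
    rw [Finset.sum_comm]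
    exact Finset.sum_congr rfl fun i _ => Finset.sum_congr rfl fun j _ => by ring
  have h1 := (S.hasMatDeriv_calabiMat_single hx q).quadForm v
  have hP := S.hasMatDeriv_ihess_single hx q
  have hX := S.hasMatDeriv_thirdDir hx (v := v) q
  have h2 := (((hP.mul hX).mul hP).mul hX).trace.congr
    (Filter.eventually_of_mem (S.isOpen.mem_nhds hx) fun y hy => (hu y hy).symm)
  rw [h1.unique h2]
  have e1 := trace_mul_comm (ihess Φ x * thirdDir Φ v x) (ihess Φ x * fourthDir Φ v q x)
  have e2 := trace_mul_comm (ihess Φ x * thirdDir Φ v x)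
    (ihess Φ x * thirdMat Φ q x * ihess Φ x * thirdDir Φ v x)
  simp only [Matrix.mul_assoc] at e1 e2
  simp only [Matrix.add_mul, trace_add, Matrix.neg_mul, Matrix.mul_neg, trace_neg,
    Matrix.mul_assoc, e1, e2]
  ring

end TransportSetting

end Laplacian

section CalabiLaplacian

open Matrix

variable {n : ℕ}

lemma dotProduct_transpose_mulVec_self (M : Matrix (Fin n) (Fin n) ℝ) (v : Fin n → ℝ) :
    v ⬝ᵥ Mᵀ *ᵥ v = v ⬝ᵥ M *ᵥ v := by
  rw [mulVec_transpose, dotProduct_comm, ← dotProduct_mulVec]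

/-- The derivative of the Calabi tensor in the coordinate direction `q`. -/
def calabiDeriv (Φ : (Fin n → ℝ) → ℝ) (q : Fin n) (x : Fin n → ℝ) : Matrix (Fin n) (Fin n) ℝ :=
  calabiVariation (ihess Φ x) (thirdMat Φ q x) (fun i => thirdMat Φ i x)
    (fun i => fourthMat Φ i q x)

/-- The second derivative of `g(v,v)` in the coordinate directions `p` and `q`. -/
def calabiSecondDeriv (Φ : (Fin n → ℝ) → ℝ) (v : Fin n → ℝ) (p q : Fin n) (x : Fin n → ℝ) : ℝ :=
  let P := ihess Φ x
  let X := thirdDir Φ v x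
  2 * ((P * fifthDir Φ v q p x * P * X).trace
      - (P * thirdMat Φ p x * P * fourthDir Φ v q x * P * X).trace
      - (P * fourthDir Φ v q x * P * thirdMat Φ p x * P * X).trace
      + (P * fourthDir Φ v q x * P * fourthDir Φ v p x).trace)
    - 2 * ((P * fourthMat Φ q p x * P * X * P * X).trace
      - (P * thirdMat Φ p x * P * thirdMat Φ q x * P * X * P * X).trace
      - (P * thirdMat Φ q x * P * thirdMat Φ p x * P * X * P * X).trace
      + (P * thirdMat Φ q x * P * fourthDir Φ v p x * P * X).trace
      - (P * thirdMat Φ q x * P * X * P * thirdMat Φ p x * P * X).trace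
      + (P * thirdMat Φ q x * P * X * P * fourthDir Φ v p x).trace)

namespace TransportSetting

variable {Ω : Set (Fin n → ℝ)} {Φ V W : (Fin n → ℝ) → ℝ} (S : TransportSetting Ω Φ V W)
  {x w v : Fin n → ℝ} (hx : x ∈ Ω)

include S hx

lemma hasMatDeriv_covMat_calabi (p q : Fin n) :
    HasMatDeriv (covMat Φ (calabi Φ) q) x (Pi.single p 1) (pdCovMat Φ (calabi Φ) p q x) := by
  have hP := S.hasMatDeriv_ihess_single hx p
  have hT := fun i => hasMatDeriv_thirdMat_single S.isOpen S.potential hx (by norm_num) i p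
  have hF := fun i => hasMatDeriv_fourthMat_single S.isOpen S.potential hx (by norm_num) i q p
  have hG := S.hasMatDeriv_calabiMat_single hx p
  refine fun i j => ⟨?_, rfl⟩
  have hD := (((((hP.mul (hF i)).mul hP).mul (hT j)).trace.add
    (((hP.mul (hT i)).mul hP).mul (hF j)).trace).sub
    (((((hP.mul (hT q)).mul hP).mul (hT i)).mul hP).mul (hT j)).trace).sub
    (((((hP.mul (hT i)).mul hP).mul (hT q)).mul hP).mul (hT j)).trace
  have hC := ((((hT q).mul hP).mul hG).add ((hG.mul hP).mul (hT q))).const_smul (1 / 2)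
  exact ((hD.sub (hC i j)).congr (Filter.eventually_of_mem (S.isOpen.mem_nhds hx) fun y hy =>
    (congrFun (congrFun (S.covMat_calabi hy q) i) j).symm)).1

lemma quadForm_covMat_calabi (q : Fin n) : v ⬝ᵥ covMat Φ (calabi Φ) q x *ᵥ v =
    2 * (ihess Φ x * fourthDir Φ v q x * ihess Φ x * thirdDir Φ v x).trace
      - 2 * (ihess Φ x * thirdMat Φ q x * ihess Φ x * thirdDir Φ v x * ihess Φ x
        * thirdDir Φ v x).trace
      - v ⬝ᵥ (thirdMat Φ q x * ihess Φ x * calabiMat Φ x) *ᵥ v := by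
  have h : calabiMat Φ x * ihess Φ x * thirdMat Φ q x
      = (thirdMat Φ q x * ihess Φ x * calabiMat Φ x)ᵀ := by
    simp only [transpose_mul, S.ihess_symm hx, S.third_symm hx, S.calabiMat_symm hx,
      Matrix.mul_assoc]
  rw [S.covMat_calabi hx, sub_mulVec, dotProduct_sub, S.quadForm_calabiVariation hx, smul_mulVec,
    dotProduct_smul, add_mulVec, dotProduct_add, h, dotProduct_transpose_mulVec_self, smul_eq_mul]
  ring

lemma quadForm_pdCovMat_calabi (p q : Fin n) : v ⬝ᵥ pdCovMat Φ (calabi Φ) p q x *ᵥ v =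
    calabiSecondDeriv Φ v p q x
      - (v ⬝ᵥ (fourthMat Φ q p x * ihess Φ x * calabiMat Φ x) *ᵥ v
        - v ⬝ᵥ (thirdMat Φ q x * ihess Φ x * thirdMat Φ p x * ihess Φ x * calabiMat Φ x) *ᵥ v
        + v ⬝ᵥ (thirdMat Φ q x * ihess Φ x * calabiDeriv Φ p x) *ᵥ v) := by
  have hP := S.hasMatDeriv_ihess_single hx p
  have hT := hasMatDeriv_thirdMat_single S.isOpen S.potential hx (by norm_num) q p
  have hX := S.hasMatDeriv_thirdDir hx (v := v) p
  have hQ := S.hasMatDeriv_fourthDir hx (v := v) q p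
  have hG := S.hasMatDeriv_calabiMat_single hx p
  have h1 := ((((((hP.mul hQ).mul hP).mul hX).trace.const_mul 2).sub
    ((((((hP.mul hT).mul hP).mul hX).mul hP).mul hX).trace.const_mul 2)).sub
    (((hT.mul hP).mul hG).quadForm v)).congr
    (Filter.eventually_of_mem (S.isOpen.mem_nhds hx) fun y hy =>
      (S.quadForm_covMat_calabi hy q).symm)
  rw [((S.hasMatDeriv_covMat_calabi hx p q).quadForm v).unique h1]
  simp only [calabiSecondDeriv, calabiDeriv, Matrix.add_mul, trace_add, Matrix.neg_mul,
    Matrix.mul_neg, trace_neg, add_mulVec, neg_mulVec, dotProduct_add, dotProduct_neg,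
    Matrix.mul_assoc]
  ring

end TransportSetting

end CalabiLaplacian

section Contraction

open Matrix

variable {n : ℕ}

namespace TransportSetting

variable {Ω : Set (Fin n → ℝ)} {Φ V W : (Fin n → ℝ) → ℝ} (S : TransportSetting Ω Φ V W)
  {x v : Fin n → ℝ} (hx : x ∈ Ω)

include S hx

lemma calabiDeriv_symm (q : Fin n) : (calabiDeriv Φ q x)ᵀ = calabiDeriv Φ q x := by
  have h : HasMatDeriv (calabiMat Φ) x (Pi.single q 1) (calabiDeriv Φ q x) :=
    S.hasMatDeriv_calabiMat_single hx q
  refine HasMatDeriv.unique (M := fun y => (calabiMat Φ y)ᵀ) (fun i j => h j i) (h.congr ?_)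
  exact Filter.eventually_of_mem (S.isOpen.mem_nhds hx) fun y hy => (S.calabiMat_symm hy).symm

lemma covMat_calabi_symm (q : Fin n) :
    (covMat Φ (calabi Φ) q x)ᵀ = covMat Φ (calabi Φ) q x := by
  have h := S.calabiDeriv_symm hx q
  rw [calabiDeriv] at h
  rw [S.covMat_calabi hx, transpose_sub, h, transpose_smul, transpose_add]
  simp only [transpose_mul, S.ihess_symm hx, S.third_symm hx, S.calabiMat_symm hx,
    Matrix.mul_assoc]
  rw [add_comm]

/-- The weighted Laplacian of the Calabi tensor contracted with a relative eigenvector. -/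
lemma quadForm_LT2_calabi {c : ℝ} (hv : v ⬝ᵥ hess Φ x *ᵥ v = 1)
    (hc : calabiMat Φ x *ᵥ v = c • hess Φ x *ᵥ v) :
    v ⬝ᵥ (Matrix.of fun i j => LT2 Φ V W (calabi Φ) i j x) *ᵥ v =
      ∑ p, ∑ q, ihess Φ x p q * calabiSecondDeriv Φ v p q x
      - ∑ m, Wop Φ W m x * (2 * (ihess Φ x * fourthDir Φ v m x * ihess Φ x * thirdDir Φ v x).trace
        - 2 * (ihess Φ x * thirdMat Φ m x * ihess Φ x * thirdDir Φ v x * ihess Φ x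
          * thirdDir Φ v x).trace)
      + c * (v ⬝ᵥ hess V x *ᵥ v - v ⬝ᵥ WhatMat Φ W x *ᵥ v) + c ^ 2 / 2
      - 2 * ∑ p, ∑ q, ihess Φ x p q *
        (v ⬝ᵥ (thirdMat Φ p x * ihess Φ x * calabiDeriv Φ q x) *ᵥ v)
      + 1 / 2 * ∑ p, ∑ q, ihess Φ x p q *
        (v ⬝ᵥ (thirdMat Φ p x * ihess Φ x * calabiMat Φ x * ihess Φ x * thirdMat Φ q x) *ᵥ v) := by
  have hPG : ∀ M : Matrix (Fin n) (Fin n) ℝ,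
      v ⬝ᵥ (M * ihess Φ x * calabiMat Φ x) *ᵥ v = c * (v ⬝ᵥ M *ᵥ v) := fun M => by
    rw [← mulVec_mulVec, hc, mulVec_smul, mulVec_mulVec, Matrix.mul_assoc, S.ihess_mul_hess hx,
      Matrix.mul_one, dotProduct_smul, smul_eq_mul]
  have hG : v ⬝ᵥ calabiMat Φ x *ᵥ v = c := by
    rw [hc, dotProduct_smul, hv, smul_eq_mul, mul_one]
  have hN : ∀ p q, v ⬝ᵥ (covMat Φ (calabi Φ) q x * ihess Φ x * thirdMat Φ p x) *ᵥ v
      = v ⬝ᵥ (thirdMat Φ p x * ihess Φ x * covMat Φ (calabi Φ) q x) *ᵥ v := fun p q => by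
    rw [← dotProduct_transpose_mulVec_self]
    simp only [transpose_mul, S.ihess_symm hx, S.third_symm hx, S.covMat_calabi_symm hx,
      Matrix.mul_assoc]
  have hTN : ∀ p q, v ⬝ᵥ (thirdMat Φ p x * ihess Φ x * covMat Φ (calabi Φ) q x) *ᵥ v
      = v ⬝ᵥ (thirdMat Φ p x * ihess Φ x * calabiDeriv Φ q x) *ᵥ v
        - 1 / 2 * (c * (v ⬝ᵥ (thirdMat Φ p x * ihess Φ x * thirdMat Φ q x) *ᵥ v))
        - 1 / 2 * (v ⬝ᵥ (thirdMat Φ p x * ihess Φ x * calabiMat Φ x * ihess Φ x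
          * thirdMat Φ q x) *ᵥ v) := fun p q => by
    rw [← hPG, S.covMat_calabi hx, ← calabiDeriv, Matrix.mul_sub, Matrix.mul_smul, Matrix.mul_add,
      sub_mulVec, smul_mulVec, add_mulVec, dotProduct_sub, dotProduct_smul, dotProduct_add,
      smul_eq_mul]
    simp only [Matrix.mul_assoc]
    ring
  have hQG : ∑ p, ∑ q, ihess Φ x p q *
      (v ⬝ᵥ (thirdMat Φ p x * ihess Φ x * thirdMat Φ q x) *ᵥ v) = c := by
    rw [← hG]
    conv_rhs => rw [S.calabiMat_eq_sum hx]
    simp only [sum_mulVec, dotProduct_sum, smul_mulVec, dotProduct_smul, smul_eq_mul]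
  have hMA : v ⬝ᵥ hess V x *ᵥ v = v ⬝ᵥ WhatMat Φ W x *ᵥ v
      + ∑ l, Wop Φ W l x * (v ⬝ᵥ thirdMat Φ l x *ᵥ v) + c
      - ∑ p, ∑ q, ihess Φ x p q * (v ⬝ᵥ fourthMat Φ p q x *ᵥ v) := by
    rw [S.hess_source hx]
    simp only [add_mulVec, sub_mulVec, dotProduct_add, dotProduct_sub, sum_mulVec, dotProduct_sum,
      smul_mulVec, dotProduct_smul, smul_eq_mul, hG]
  have hLT : v ⬝ᵥ (Matrix.of fun i j => LT2 Φ V W (calabi Φ) i j x) *ᵥ v =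
      ∑ p, ∑ q, (ihess Φ x p q * calabiSecondDeriv Φ v p q x
        - c * (ihess Φ x p q * (v ⬝ᵥ fourthMat Φ q p x *ᵥ v))
        + c * (ihess Φ x p q * (v ⬝ᵥ (thirdMat Φ q x * ihess Φ x * thirdMat Φ p x) *ᵥ v))
        - ihess Φ x p q * (v ⬝ᵥ (thirdMat Φ q x * ihess Φ x * calabiDeriv Φ p x) *ᵥ v)
        - ihess Φ x p q * (v ⬝ᵥ (thirdMat Φ p x * ihess Φ x * calabiDeriv Φ q x) *ᵥ v)
        + c / 2 * (ihess Φ x p q * (v ⬝ᵥ (thirdMat Φ p x * ihess Φ x * thirdMat Φ q x) *ᵥ v))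
        + 1 / 2 * (ihess Φ x p q * (v ⬝ᵥ (thirdMat Φ p x * ihess Φ x * calabiMat Φ x * ihess Φ x
          * thirdMat Φ q x) *ᵥ v)))
      - ∑ m, (Wop Φ W m x *
        (2 * (ihess Φ x * fourthDir Φ v m x * ihess Φ x * thirdDir Φ v x).trace
        - 2 * (ihess Φ x * thirdMat Φ m x * ihess Φ x * thirdDir Φ v x * ihess Φ x
          * thirdDir Φ v x).trace) - c * (Wop Φ W m x * (v ⬝ᵥ thirdMat Φ m x *ᵥ v))) := by
    rw [S.LT2_eq hx, sub_mulVec, dotProduct_sub]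
    simp only [sum_mulVec, dotProduct_sum, smul_mulVec, dotProduct_smul, smul_eq_mul, sub_mulVec,
      dotProduct_sub, add_mulVec, dotProduct_add, hN, hTN, S.quadForm_pdCovMat_calabi hx,
      S.quadForm_covMat_calabi hx, hPG]
    congr 1
    · exact Finset.sum_congr rfl fun p _ => Finset.sum_congr rfl fun q _ => by ring
    · exact Finset.sum_congr rfl fun m _ => by ring
  have hP := S.ihess_symm hx
  rw [hLT]
  simp only [Finset.sum_add_distrib, Finset.sum_sub_distrib, ← Finset.mul_sum]
  rw [sum_sum_swap hP fun p q => v ⬝ᵥ fourthMat Φ p q x *ᵥ v,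
    sum_sum_swap hP fun p q => v ⬝ᵥ (thirdMat Φ p x * ihess Φ x * thirdMat Φ q x) *ᵥ v,
    sum_sum_swap hP fun p q => v ⬝ᵥ (thirdMat Φ p x * ihess Φ x * calabiDeriv Φ q x) *ᵥ v, hQG,
    hMA]
  ring

end TransportSetting

end Contraction

/-! ### Evaluation of the contractions -/

section Evaluation

open Matrix

variable {n : ℕ}

lemma trace_transpose_mul_eq_sum (Y Z : Matrix (Fin n) (Fin n) ℝ) :
    (Yᵀ * Z).trace = ∑ b, ∑ e, Y b e * Z b e := by
  simp only [trace, diag_apply, mul_apply, transpose_apply]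
  exact Finset.sum_comm

/-- Exchange of the contraction indices of two totally symmetric families. -/
lemma sum_sum_mul_trace_shuffle {P : Matrix (Fin n) (Fin n) ℝ} (hP : Pᵀ = P)
    {T Q : Fin n → Matrix (Fin n) (Fin n) ℝ} (hT : ∀ p b c, T p b c = T b p c)
    (hQ : ∀ q d e, Q q d e = Q e d q) (M Y : Matrix (Fin n) (Fin n) ℝ) :
    ∑ b, ∑ e, Y b e * (P * T b * M * Q e).trace
      = ∑ p, ∑ q, P p q * (Yᵀ * T p * M * Q q).trace := by
  simp only [← sum_sum_smul_mul_mul_apply hP hT hQ]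
  rw [← trace_transpose_mul_eq_sum]
  simp only [Finset.mul_sum, trace_sum, Matrix.mul_smul, trace_smul, smul_eq_mul, Matrix.mul_assoc]

section Families

variable {P X : Matrix (Fin n) (Fin n) ℝ} (hP : Pᵀ = P) (hX : Xᵀ = X)
  {T Q : Fin n → Matrix (Fin n) (Fin n) ℝ}
  (hTl : ∀ p b c, T p b c = T b p c) (hTr : ∀ q d e, T q d e = T e d q)
  (hQr : ∀ q d e, Q q d e = Q e d q)

include hP hX hTl

include hQr in
lemma sum_sum_mul_trace_two :
    ∑ b, ∑ e, (P * X * P) b e * (P * T b * P * Q e).trace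
      = ∑ p, ∑ q, P p q * (P * T p * P * Q q * P * X).trace := by
  rw [sum_sum_mul_trace_shuffle hP hTl hQr]
  refine Finset.sum_congr rfl fun p _ => Finset.sum_congr rfl fun q _ => ?_
  rw [← trace_cycle_three P X (T p) (Q q)]
  simp only [transpose_mul, hP, hX, Matrix.mul_assoc]

include hTr in
lemma sum_sum_mul_trace_three :
    ∑ b, ∑ e, (P * X * P) b e * (P * T b * P * X * P * T e).trace
      = ∑ p, ∑ q, P p q * (P * T p * P * X * P * T q * P * X).trace := by
  have h := sum_sum_mul_trace_shuffle hP hTl hTr (P * X * P) (P * X * P)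
  simp only [transpose_mul, hP, hX, ← Matrix.mul_assoc] at h
  rw [h]
  exact Finset.sum_congr rfl fun p _ => Finset.sum_congr rfl fun q _ => by
    rw [trace_cycle_four P X (T p) X (T q)]

omit hTl in
lemma sum_sum_swap_mul (f : Fin n → Fin n → ℝ) :
    ∑ b, ∑ e, (P * X * P) b e * f e b = ∑ b, ∑ e, (P * X * P) b e * f b e :=
  sum_sum_swap (by simp only [transpose_mul, hP, hX, Matrix.mul_assoc]) f

include hTr hQr in
lemma trace_calabiVariation : (P * calabiVariation P X T Q * P * X).trace =
    2 * ∑ p, ∑ q, P p q * (P * T p * P * Q q * P * X).trace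
      - 2 * ∑ p, ∑ q, P p q * (P * T p * P * X * P * T q * P * X).trace := by
  have h1 : (P * calabiVariation P X T Q * P * X).trace
      = ((P * X * P)ᵀ * calabiVariation P X T Q).trace := by
    simp only [transpose_mul, hP, hX]
    simpa only [Matrix.mul_assoc] using trace_mul_comm (P * calabiVariation P X T Q) (P * X)
  have e1 : ∀ b e, (P * Q b * P * T e).trace = (P * T e * P * Q b).trace := fun b e => by
    simpa only [Matrix.mul_assoc] using trace_mul_comm (P * Q b) (P * T e)
  have e2 : ∀ b e, (P * X * P * T b * P * T e).trace = (P * T e * P * X * P * T b).trace :=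
    fun b e => (trace_cycle_three P (T e) X (T b)).symm
  rw [h1, trace_transpose_mul_eq_sum]
  simp only [calabiVariation, of_apply, mul_add, mul_sub, Finset.sum_add_distrib,
    Finset.sum_sub_distrib, e1, e2]
  rw [sum_sum_swap_mul hP hX fun b e => (P * T b * P * Q e).trace,
    sum_sum_swap_mul hP hX fun b e => (P * T b * P * X * P * T e).trace,
    sum_sum_mul_trace_two hP hX hTl hQr, sum_sum_mul_trace_three hP hX hTl hTr]
  ring

end Families

end Evaluation

section PointwiseIdentity

open Matrix

variable {n : ℕ}

namespace TransportSetting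

variable {Ω : Set (Fin n → ℝ)} {Φ V W : (Fin n → ℝ) → ℝ} (S : TransportSetting Ω Φ V W)
  {x v : Fin n → ℝ} (hx : x ∈ Ω)

include S hx

lemma thirdMat_mulVec (p a : Fin n) : (thirdMat Φ p x *ᵥ v) a = thirdDir Φ v x a p := by
  simp only [mulVec, dotProduct, thirdDir, Matrix.sum_apply, Matrix.smul_apply, smul_eq_mul]
  exact Finset.sum_congr rfl fun b _ => by rw [mul_comm, S.third_swap_right hx]

lemma trace_thirdMat_thirdDir (l : Fin n) :
    (ihess Φ x * thirdMat Φ l x * ihess Φ x * thirdDir Φ v x).trace = (calabiMat Φ x *ᵥ v) l := by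
  simp only [mulVec, dotProduct, calabiMat, of_apply, thirdDir, S.calabi_eq_trace hx,
    Finset.mul_sum, Matrix.mul_smul, trace_sum, trace_smul, smul_eq_mul, mul_comm (v _)]

lemma quadForm_thirdMat_mul (p : Fin n) (M : Matrix (Fin n) (Fin n) ℝ) :
    v ⬝ᵥ (thirdMat Φ p x * M) *ᵥ v = ((thirdDir Φ v x * M) *ᵥ v) p := by
  have h : v ᵥ* thirdMat Φ p x = fun a => thirdDir Φ v x p a := by
    rw [← mulVec_transpose, S.third_symm hx]
    ext a
    rw [S.thirdMat_mulVec hx]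
    exact congrFun (congrFun (S.thirdDir_symm hx (v := v)) p) a
  rw [← mulVec_mulVec, dotProduct_mulVec, h, ← mulVec_mulVec]
  rfl

lemma sum_quadForm_third_calabi_third : ∑ p, ∑ q, ihess Φ x p q *
      (v ⬝ᵥ (thirdMat Φ p x * ihess Φ x * calabiMat Φ x * ihess Φ x * thirdMat Φ q x) *ᵥ v) =
    (ihess Φ x * calabiMat Φ x * ihess Φ x * thirdDir Φ v x * ihess Φ x
      * thirdDir Φ v x).trace := by
  have h : ∀ p q, v ⬝ᵥ (thirdMat Φ p x * ihess Φ x * calabiMat Φ x * ihess Φ x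
      * thirdMat Φ q x) *ᵥ v
      = (thirdDir Φ v x * ihess Φ x * calabiMat Φ x * ihess Φ x * thirdDir Φ v x) p q := by
    intro p q
    simp only [Matrix.mul_assoc]
    rw [S.quadForm_thirdMat_mul hx]
    simp only [← Matrix.mul_assoc]
    rw [← mulVec_mulVec, mul_apply]
    change ∑ a, _ * (thirdMat Φ q x *ᵥ v) a = _
    exact Finset.sum_congr rfl fun a _ => by rw [S.thirdMat_mulVec hx]
  simp only [h]
  rw [← trace_transpose_mul_eq_sum, S.ihess_symm hx]
  simpa only [Matrix.mul_assoc] using trace_mul_comm (ihess Φ x * thirdDir Φ v x)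
    (ihess Φ x * calabiMat Φ x * ihess Φ x * thirdDir Φ v x)

omit S hx in
lemma calabiDeriv_mulVec (q m : Fin n) : (calabiDeriv Φ q x *ᵥ v) m =
    (ihess Φ x * fourthMat Φ m q x * ihess Φ x * thirdDir Φ v x).trace
      + (ihess Φ x * thirdMat Φ m x * ihess Φ x * fourthDir Φ v q x).trace
      - (ihess Φ x * thirdMat Φ q x * ihess Φ x * thirdMat Φ m x * ihess Φ x
        * thirdDir Φ v x).trace
      - (ihess Φ x * thirdMat Φ m x * ihess Φ x * thirdMat Φ q x * ihess Φ x
        * thirdDir Φ v x).trace := by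
  simp only [mulVec, dotProduct, calabiDeriv, calabiVariation, of_apply, thirdDir, fourthDir,
    Finset.mul_sum, Matrix.mul_smul, trace_sum, trace_smul, smul_eq_mul, add_mul, sub_mul,
    Finset.sum_add_distrib, Finset.sum_sub_distrib, mul_comm (v _)]

lemma sum_quadForm_third_calabiDeriv : ∑ p, ∑ q, ihess Φ x p q *
      (v ⬝ᵥ (thirdMat Φ p x * ihess Φ x * calabiDeriv Φ q x) *ᵥ v) =
    (ihess Φ x * (∑ p, ∑ q, (ihess Φ x * thirdDir Φ v x * ihess Φ x) p q • fourthMat Φ p q x)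
      * ihess Φ x * thirdDir Φ v x).trace
    + ∑ p, ∑ q, ihess Φ x p q * (ihess Φ x * thirdMat Φ p x * ihess Φ x * fourthDir Φ v q x
      * ihess Φ x * thirdDir Φ v x).trace
    - 2 * ∑ p, ∑ q, ihess Φ x p q * (ihess Φ x * thirdMat Φ p x * ihess Φ x * thirdDir Φ v x
      * ihess Φ x * thirdMat Φ q x * ihess Φ x * thirdDir Φ v x).trace := by
  have hP := S.ihess_symm hx
  have hX := S.thirdDir_symm hx (v := v)
  have h1 : ∑ p, ∑ q, ihess Φ x p q *
      (v ⬝ᵥ (thirdMat Φ p x * ihess Φ x * calabiDeriv Φ q x) *ᵥ v)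
      = ∑ q, ∑ m, (ihess Φ x * thirdDir Φ v x * ihess Φ x) q m * (calabiDeriv Φ q x *ᵥ v) m := by
    rw [← sum_sum_swap hP]
    refine Finset.sum_congr rfl fun q _ => ?_
    have h2 : ∀ p, v ⬝ᵥ (thirdMat Φ p x * ihess Φ x * calabiDeriv Φ q x) *ᵥ v
        = ((thirdDir Φ v x * ihess Φ x) *ᵥ calabiDeriv Φ q x *ᵥ v) p := fun p => by
      rw [Matrix.mul_assoc, S.quadForm_thirdMat_mul hx, ← Matrix.mul_assoc, mulVec_mulVec]
    simp only [h2]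
    change (ihess Φ x *ᵥ (thirdDir Φ v x * ihess Φ x) *ᵥ calabiDeriv Φ q x *ᵥ v) q
      = ((ihess Φ x * thirdDir Φ v x * ihess Φ x) *ᵥ calabiDeriv Φ q x *ᵥ v) q
    rw [mulVec_mulVec, Matrix.mul_assoc]
  have e1 : ∀ m q, (ihess Φ x * thirdMat Φ m x * ihess Φ x * thirdMat Φ q x * ihess Φ x
      * thirdDir Φ v x).trace = (ihess Φ x * thirdMat Φ q x * ihess Φ x * thirdDir Φ v x
        * ihess Φ x * thirdMat Φ m x).trace := fun m q => trace_cycle_three _ _ _ _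
  have h3 : (ihess Φ x * (∑ p, ∑ q, (ihess Φ x * thirdDir Φ v x * ihess Φ x) p q
      • fourthMat Φ p q x) * ihess Φ x * thirdDir Φ v x).trace
      = ∑ p, ∑ q, (ihess Φ x * thirdDir Φ v x * ihess Φ x) p q
        * (ihess Φ x * fourthMat Φ p q x * ihess Φ x * thirdDir Φ v x).trace := by
    simp only [Finset.mul_sum, Finset.sum_mul, Matrix.mul_smul, Matrix.smul_mul, trace_sum,
      trace_smul, smul_eq_mul]
  rw [h1]
  simp only [calabiDeriv_mulVec, mul_add, mul_sub, Finset.sum_add_distrib,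
    Finset.sum_sub_distrib, e1]
  rw [sum_sum_swap_mul hP hX fun m q =>
      (ihess Φ x * thirdMat Φ m x * ihess Φ x * fourthDir Φ v q x).trace,
    sum_sum_swap_mul hP hX fun m q => (ihess Φ x * thirdMat Φ m x * ihess Φ x * thirdDir Φ v x
      * ihess Φ x * thirdMat Φ q x).trace,
    sum_sum_swap_mul hP hX fun m q =>
      (ihess Φ x * fourthMat Φ m q x * ihess Φ x * thirdDir Φ v x).trace,
    sum_sum_mul_trace_two hP hX (S.third_swap_left hx) (S.fourthDir_swap_right hx),
    sum_sum_mul_trace_three hP hX (S.third_swap_left hx) (S.third_swap_right hx), h3]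
  ring

/-- The third derivative of the Monge–Ampère equation contracted with `∂_v D²Φ`. -/
lemma trace_third_source {c : ℝ} (hc : calabiMat Φ x *ᵥ v = c • hess Φ x *ᵥ v) :
    (ihess Φ x * (∑ p, ∑ q, ihess Φ x p q • fifthDir Φ v q p x
      - ∑ l, Wop Φ W l x • fourthDir Φ v l x) * ihess Φ x * thirdDir Φ v x).trace =
    (ihess Φ x * (∑ p, ∑ q, (ihess Φ x * thirdDir Φ v x * ihess Φ x) p q • fourthMat Φ p q x)
      * ihess Φ x * thirdDir Φ v x).trace
    + c * (v ⬝ᵥ WhatMat Φ W x *ᵥ v)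
    + 2 * (ihess Φ x * WhatMat Φ W x * ihess Φ x * thirdDir Φ v x * ihess Φ x
      * thirdDir Φ v x).trace
    + 2 * ∑ p, ∑ q, ihess Φ x p q * (ihess Φ x * thirdMat Φ p x * ihess Φ x * fourthDir Φ v q x
      * ihess Φ x * thirdDir Φ v x).trace
    - 2 * ∑ p, ∑ q, ihess Φ x p q * (ihess Φ x * thirdMat Φ p x * ihess Φ x * thirdDir Φ v x
      * ihess Φ x * thirdMat Φ q x * ihess Φ x * thirdDir Φ v x).trace
    - (ihess Φ x * (∑ i, v i • Smat Φ V W i x) * ihess Φ x * thirdDir Φ v x).trace := by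
  have hP := S.ihess_symm hx
  have hX := S.thirdDir_symm hx (v := v)
  have hhP : ∀ M, hess Φ x * (ihess Φ x * M) = M := fun M => by
    rw [← Matrix.mul_assoc, S.hess_mul_ihess hx, Matrix.one_mul]
  have hPh : ∀ M, ihess Φ x * (hess Φ x * M) = M := fun M => by
    rw [← Matrix.mul_assoc, S.ihess_mul_hess hx, Matrix.one_mul]
  have h1 : (ihess Φ x * (∑ l, (hessAtGrad Φ W x *ᵥ hess Φ x *ᵥ v) l • thirdMat Φ l x)
      * ihess Φ x * thirdDir Φ v x).trace = c * (v ⬝ᵥ WhatMat Φ W x *ᵥ v) := by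
    simp only [Finset.mul_sum, Finset.sum_mul, Matrix.mul_smul, Matrix.smul_mul, trace_sum,
      trace_smul, smul_eq_mul, S.trace_thirdMat_thirdDir hx]
    change (hessAtGrad Φ W x *ᵥ hess Φ x *ᵥ v) ⬝ᵥ (calabiMat Φ x *ᵥ v) = _
    rw [hc, dotProduct_smul, smul_eq_mul, dotProduct_comm, S.WhatMat_eq hx, Matrix.mul_assoc,
      ← mulVec_mulVec, ← mulVec_mulVec, dotProduct_mulVec v, ← mulVec_transpose, S.hess_symm hx]
  have h3 : (ihess Φ x * (thirdDir Φ v x * hessAtGrad Φ W x * hess Φ x) * ihess Φ x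
      * thirdDir Φ v x).trace = (ihess Φ x * WhatMat Φ W x * ihess Φ x * thirdDir Φ v x * ihess Φ x
      * thirdDir Φ v x).trace := by
    rw [S.WhatMat_eq hx]
    simp only [Matrix.mul_assoc, hhP, hPh]
    rw [trace_mul_comm (ihess Φ x)]
    simp only [Matrix.mul_assoc]
    rw [trace_mul_comm (thirdDir Φ v x)]
    simp only [Matrix.mul_assoc]
  have h4 : (ihess Φ x * (hess Φ x * hessAtGrad Φ W x * thirdDir Φ v x) * ihess Φ x
      * thirdDir Φ v x).trace = (ihess Φ x * WhatMat Φ W x * ihess Φ x * thirdDir Φ v x * ihess Φ x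
      * thirdDir Φ v x).trace := by
    rw [S.WhatMat_eq hx]
    simp only [Matrix.mul_assoc, hhP, hPh]
  rw [S.third_source hx]
  simp only [Matrix.mul_add, Matrix.add_mul, Matrix.mul_sub, Matrix.sub_mul, trace_add, trace_sub]
  rw [h1, h3, h4, trace_calabiVariation hP hX (S.third_swap_left hx) (S.third_swap_right hx)
    (S.fourthDir_swap_right hx)]
  ring

end TransportSetting

end PointwiseIdentity

section Bochner

open Matrix

variable {n : ℕ}

namespace TransportSetting

variable {Ω : Set (Fin n → ℝ)} {Φ V W : (Fin n → ℝ) → ℝ} (S : TransportSetting Ω Φ V W)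
  {x v : Fin n → ℝ} (hx : x ∈ Ω)

include S hx

lemma trace_calabiMat_mul (M : Matrix (Fin n) (Fin n) ℝ) :
    (ihess Φ x * calabiMat Φ x * M).trace = ∑ p, ∑ q, ihess Φ x p q *
      (ihess Φ x * thirdMat Φ p x * ihess Φ x * thirdMat Φ q x * M).trace := by
  rw [S.calabiMat_eq_sum hx]
  simp only [Finset.mul_sum, Finset.sum_mul, Matrix.mul_smul, Matrix.smul_mul, trace_sum,
    trace_smul, smul_eq_mul, ← Matrix.mul_assoc]

lemma sum_calabiSecondDeriv : ∑ p, ∑ q, ihess Φ x p q * calabiSecondDeriv Φ v p q x =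
    2 * ∑ p, ∑ q, ihess Φ x p q * (ihess Φ x * fifthDir Φ v q p x * ihess Φ x
      * thirdDir Φ v x).trace
    + 2 * ∑ p, ∑ q, ihess Φ x p q * (ihess Φ x * fourthDir Φ v p x * ihess Φ x
      * fourthDir Φ v q x).trace
    - 8 * ∑ p, ∑ q, ihess Φ x p q * (ihess Φ x * thirdMat Φ p x * ihess Φ x * fourthDir Φ v q x
      * ihess Φ x * thirdDir Φ v x).trace
    - 2 * ∑ p, ∑ q, ihess Φ x p q * (ihess Φ x * fourthMat Φ p q x * ihess Φ x
      * thirdDir Φ v x * ihess Φ x * thirdDir Φ v x).trace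
    + 4 * ∑ p, ∑ q, ihess Φ x p q * (ihess Φ x * thirdMat Φ p x * ihess Φ x * thirdMat Φ q x
      * ihess Φ x * thirdDir Φ v x * ihess Φ x * thirdDir Φ v x).trace
    + 2 * ∑ p, ∑ q, ihess Φ x p q * (ihess Φ x * thirdMat Φ p x * ihess Φ x * thirdDir Φ v x
      * ihess Φ x * thirdMat Φ q x * ihess Φ x * thirdDir Φ v x).trace := by
  have hP := S.ihess_symm hx
  have hX := S.thirdDir_symm hx (v := v)
  set P := ihess Φ x
  set X := thirdDir Φ v x
  set a : Fin n → Fin n → ℝ := fun p q =>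
    (P * thirdMat Φ p x * P * fourthDir Φ v q x * P * X).trace with ha
  set c : Fin n → Fin n → ℝ := fun p q =>
    (P * thirdMat Φ p x * P * thirdMat Φ q x * P * X * P * X).trace with hc
  set t : Fin n → Fin n → ℝ := fun p q =>
    (P * thirdMat Φ p x * P * X * P * thirdMat Φ q x * P * X).trace with ht
  set b : Fin n → Fin n → ℝ := fun p q =>
    (P * fourthDir Φ v p x * P * fourthDir Φ v q x).trace with hb
  set d : Fin n → Fin n → ℝ := fun p q =>
    (P * fourthMat Φ p q x * P * X * P * X).trace with hd
  have h : ∀ p q, P p q * calabiSecondDeriv Φ v p q x =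
      2 * (P p q * (P * fifthDir Φ v q p x * P * X).trace) - 4 * (P p q * a p q)
      - 4 * (P p q * a q p) + 2 * (P p q * b q p) - 2 * (P p q * d q p) + 2 * (P p q * c p q)
      + 2 * (P p q * c q p) + 2 * (P p q * t q p) := by
    intro p q
    have r1 : (P * fourthDir Φ v q x * P * thirdMat Φ p x * P * X).trace = a p q := by
      rw [trace_reverse_three hP (S.fourthDir_symm hx q) (S.third_symm hx p) hX,
        trace_cycle_three]
    have r2 : (P * thirdMat Φ q x * P * X * P * fourthDir Φ v p x).trace = a q p := by
      rw [trace_reverse_three hP (S.third_symm hx q) hX (S.fourthDir_symm hx p),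
        ← trace_cycle_three]
    simp only [calabiSecondDeriv]
    rw [r1, r2]
    simp only [ha, hb, hc, hd, ht]
    ring
  simp only [h, Finset.sum_add_distrib, Finset.sum_sub_distrib, ← Finset.mul_sum]
  rw [sum_sum_swap hP a, sum_sum_swap hP b, sum_sum_swap hP c, sum_sum_swap hP d,
    sum_sum_swap hP t]
  ring

/-- A Bochner formula: the weighted Laplacian of the Calabi tensor in an eigendirection. -/
lemma quadForm_LT2_calabi_eq {c : ℝ} (hv : v ⬝ᵥ hess Φ x *ᵥ v = 1)
    (hc : calabiMat Φ x *ᵥ v = c • hess Φ x *ᵥ v) :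
    v ⬝ᵥ (Matrix.of fun i j => LT2 Φ V W (calabi Φ) i j x) *ᵥ v =
    c * (v ⬝ᵥ Amat Φ V W x *ᵥ v)
    + 2 * (ihess Φ x * Amat Φ V W x * ihess Φ x * thirdDir Φ v x * ihess Φ x
      * thirdDir Φ v x).trace
    - 2 * (ihess Φ x * (∑ i, v i • Smat Φ V W i x) * ihess Φ x * thirdDir Φ v x).trace
    + (2 * ∑ p, ∑ q, ihess Φ x p q * (ihess Φ x * fourthDir Φ v p x * ihess Φ x
        * fourthDir Φ v q x).trace
      - 6 * ∑ p, ∑ q, ihess Φ x p q * (ihess Φ x * thirdMat Φ p x * ihess Φ x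
        * fourthDir Φ v q x * ihess Φ x * thirdDir Φ v x).trace
      + (5 / 2) * ∑ p, ∑ q, ihess Φ x p q * (ihess Φ x * thirdMat Φ p x * ihess Φ x
        * thirdMat Φ q x * ihess Φ x * thirdDir Φ v x * ihess Φ x * thirdDir Φ v x).trace
      + 2 * ∑ p, ∑ q, ihess Φ x p q * (ihess Φ x * thirdMat Φ p x * ihess Φ x * thirdDir Φ v x
        * ihess Φ x * thirdMat Φ q x * ihess Φ x * thirdDir Φ v x).trace)
    + c ^ 2 / 2 := by
  have hA : Amat Φ V W x = hess V x + WhatMat Φ W x := rfl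
  have h1 := S.trace_third_source hx hc
  have h2 := S.trace_calabiMat_mul hx
    (ihess Φ x * thirdDir Φ v x * ihess Φ x * thirdDir Φ v x)
  have h3 : (ihess Φ x * hess V x * ihess Φ x * thirdDir Φ v x * ihess Φ x
      * thirdDir Φ v x).trace = (ihess Φ x * WhatMat Φ W x * ihess Φ x * thirdDir Φ v x * ihess Φ x
      * thirdDir Φ v x).trace + ∑ l, Wop Φ W l x * (ihess Φ x * thirdMat Φ l x * ihess Φ x
      * thirdDir Φ v x * ihess Φ x * thirdDir Φ v x).trace
      + (ihess Φ x * calabiMat Φ x * ihess Φ x * thirdDir Φ v x * ihess Φ x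
      * thirdDir Φ v x).trace - ∑ p, ∑ q, ihess Φ x p q * (ihess Φ x * fourthMat Φ p q x * ihess Φ x
      * thirdDir Φ v x * ihess Φ x * thirdDir Φ v x).trace := by
    rw [S.hess_source hx]
    simp only [Finset.mul_sum, Finset.sum_mul, Matrix.mul_smul, Matrix.smul_mul, trace_sum,
      trace_smul, smul_eq_mul, Matrix.mul_add, Matrix.add_mul, Matrix.mul_sub,
      Matrix.sub_mul, trace_add, trace_sub]
  have h4 : (ihess Φ x * (∑ p, ∑ q, ihess Φ x p q • fifthDir Φ v q p x
      - ∑ l, Wop Φ W l x • fourthDir Φ v l x) * ihess Φ x * thirdDir Φ v x).trace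
      = ∑ p, ∑ q, ihess Φ x p q * (ihess Φ x * fifthDir Φ v q p x * ihess Φ x
        * thirdDir Φ v x).trace
        - ∑ l, Wop Φ W l x * (ihess Φ x * fourthDir Φ v l x * ihess Φ x
        * thirdDir Φ v x).trace := by
    simp only [Finset.mul_sum, Finset.sum_mul, Matrix.mul_smul, Matrix.smul_mul, trace_sum,
      trace_smul, smul_eq_mul, Matrix.mul_sub, Matrix.sub_mul, trace_sub]
  simp only [← Matrix.mul_assoc] at h2
  rw [S.quadForm_LT2_calabi hx hv hc, S.sum_calabiSecondDeriv hx,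
    S.sum_quadForm_third_calabi_third hx, S.sum_quadForm_third_calabiDeriv hx, hA]
  simp only [Matrix.mul_add, Matrix.add_mul, trace_add, add_mulVec, dotProduct_add, mul_sub,
    Finset.sum_sub_distrib, mul_left_comm (Wop Φ W _ x), ← Finset.mul_sum]
  linarith

end TransportSetting

end Bochner

/-! ### The differential inequality -/

section Inequality

open Matrix

variable {n : ℕ}

namespace TransportSetting

variable {Ω : Set (Fin n → ℝ)} {Φ V W : (Fin n → ℝ) → ℝ} (S : TransportSetting Ω Φ V W)
  {x v : Fin n → ℝ} (hx : x ∈ Ω)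

include S hx

lemma quadForm_calabiMat_nonneg : 0 ≤ v ⬝ᵥ calabiMat Φ x *ᵥ v := by
  have h : v ⬝ᵥ calabiMat Φ x *ᵥ v
      = (ihess Φ x * (thirdDir Φ v x * ihess Φ x * (thirdDir Φ v x)ᴴ)).trace := by
    have h1 : ∀ M, (ihess Φ x * thirdDir Φ v x * M).trace
        = ∑ l, v l * (ihess Φ x * thirdMat Φ l x * M).trace := fun M => by
      simp only [thirdDir, Finset.mul_sum, Finset.sum_mul, Matrix.mul_smul, Matrix.smul_mul,
        trace_sum, trace_smul, smul_eq_mul]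
    rw [conjTranspose_eq_transpose_of_trivial, S.thirdDir_symm hx, Matrix.mul_assoc,
      ← Matrix.mul_assoc, h1]
    simp only [dotProduct, ← S.trace_thirdMat_thirdDir hx, ← Matrix.mul_assoc]
  rw [h]
  exact trace_mul_nonneg (S.ihess_posDef hx).posSemidef
    ((S.ihess_posDef hx).posSemidef.mul_mul_conjTranspose_same _)

omit S hx in
lemma quadForm_Hten : v ⬝ᵥ (Matrix.of fun i j => Hten Φ V W i j x) *ᵥ v =
    ((Amat Φ V W x)⁻¹ * (∑ i, v i • Smat Φ V W i x) * ihess Φ x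
      * (∑ i, v i • Smat Φ V W i x)).trace := by
  rw [← sum_sum_mul_mul_eq_dotProduct]
  simp only [Hten, ihess, Finset.mul_sum, Finset.sum_mul, Matrix.mul_smul, Matrix.smul_mul,
    trace_sum, trace_smul, smul_eq_mul]
  rw [Finset.sum_comm]
  exact Finset.sum_congr rfl fun i _ => Finset.sum_congr rfl fun j _ => by ring

lemma sq_le_hnorm_add_quadForm_LT2 {c : ℝ} (hA : (Amat Φ V W x).PosDef)
    (hv : v ⬝ᵥ hess Φ x *ᵥ v = 1) (hc : calabiMat Φ x *ᵥ v = c • hess Φ x *ᵥ v) :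
    c ^ 2 ≤ hnorm Φ (fun i j => Hten Φ V W i j x) x
      + 2 * (v ⬝ᵥ (Matrix.of fun i j => LT2 Φ V W (calabi Φ) i j x) *ᵥ v) := by
  have hX := S.thirdDir_symm hx (v := v)
  have hP := (S.ihess_posDef hx).posSemidef
  have hc0 : 0 ≤ c := by
    have h := S.quadForm_calabiMat_nonneg hx (v := v)
    rwa [hc, dotProduct_smul, hv, smul_eq_mul, mul_one] at h
  have hAv : 0 ≤ v ⬝ᵥ Amat Φ V W x *ᵥ v := by
    simpa using hA.posSemidef.dotProduct_mulVec_nonneg v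
  have hH := dotProduct_mulVec_le_hnorm (S.posDef x hx) (fun i j => Hten Φ V W i j x) v hv
  have hsq := trace_completed_square_nonneg hA hP hX (S.sum_smul_Smat_symm hx (v := v))
  have hrem := calabi_remainder_nonneg hP hX (S.third_symm hx)
    (S.fourthDir_symm hx (v := v))
  rw [quadForm_Hten] at hH
  rw [S.quadForm_LT2_calabi_eq hx hv hc]
  have := mul_nonneg hc0 hAv
  linarith

end TransportSetting

end Inequality

/-- at a vector attaining the `h`-norm of `g`,
`‖H‖_h + 2 (Lg)(v,v) ≥ ‖g‖_h²`. -/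
theorem stmt_13 {n : ℕ} (Ω : Set (Fin n → ℝ)) (hΩ : IsOpen Ω)
    (Φ V W : (Fin n → ℝ) → ℝ)
    (hΦ : ContDiffOn ℝ 5 Φ Ω) (hΦconv : ConvexOn ℝ Ω Φ)
    (hpos : ∀ x ∈ Ω, (hess Φ x).PosDef)
    (hV : ContDiffOn ℝ 3 V Ω) (hW : ContDiff ℝ 3 W)
    (hMA : ∀ x ∈ Ω, Real.exp (-V x) = Real.exp (-W (grad Φ x)) * (hess Φ x).det)
    (hA : ∀ x ∈ Ω, (Amat Φ V W x).PosDef) :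
    ∀ x ∈ Ω, ∀ v : Fin n → ℝ,
      (∑ i, ∑ j, pd2 Φ i j x * v i * v j) = 1 →
      (∑ i, ∑ j, calabi Φ i j x * v i * v j) = hnorm Φ (fun i j => calabi Φ i j x) x →
      hnorm Φ (fun i j => Hten Φ V W i j x) x
        + 2 * ∑ i, ∑ j, LT2 Φ V W (calabi Φ) i j x * v i * v j
      ≥ (hnorm Φ (fun i j => calabi Φ i j x) x) ^ 2 := by
  intro x hx v hv hmax
  have S : TransportSetting Ω Φ V W :=
    ⟨hΩ, mod_cast hΦ, hpos, mod_cast hV, mod_cast hW, hMA⟩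
  rw [sum_sum_mul_mul_eq_dotProduct] at hv hmax ⊢
  have hvec := mulVec_eq_hnorm_smul (hpos x hx) _ (S.calabiMat_symm hx) v hv hmax
  exact S.sq_le_hnorm_add_quadForm_LT2 hx (hA x hx) hv hvec
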